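/- arXiv:1801.10087 — 2 statements merged into one kernel-verified Lean document; each statement's English description precedes it below -/
import Mathlib

section
/- For every population size function µ = µ(n) with µ ≥ 2, the (µ+1) EA with population-level fitness sharing finds both optima of TwoMax in expected O(µ n log n) generations. -/
open Filter
open scoped ENNReal BigOperators Classical

noncomputable section

abbrev BitString (n : ℕ) := Fin n → Bool

def onesCount {n : ℕ} (x : BitString n) : ℕ := (Finset.univ.filter fun i => x i = true).card

def allOnes (n : ℕ) : BitString n := fun _ => true
def allZeros (n : ℕ) : BitString n := fun _ => false

def twoMax {n : ℕ} (x : BitString n) : ℕ := max (onesCount x) (n - onesCount x)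

/-- probability that standard bit mutation with rate `1/n` creates `y` from `x` -/
def mutProb (n : ℕ) (x y : BitString n) : ℝ≥0∞ :=
  ((n : ℝ≥0∞)⁻¹) ^ hammingDist x y * (1 - (n : ℝ≥0∞)⁻¹) ^ (n - hammingDist x y)

/-- distribution of a (time-homogeneous) finite Markov chain after `t` steps -/
def evolve {S : Type*} [Fintype S] (init : S → ℝ≥0∞) (trans : S → S → ℝ≥0∞) : ℕ → S → ℝ≥0∞
  | 0 => init
  | t + 1 => fun s' => ∑ s, evolve init trans t s * trans s s'

/-- probability of an event under a (sub)distribution -/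
def probOf {S : Type*} [Fintype S] (d : S → ℝ≥0∞) (A : S → Prop) : ℝ≥0∞ :=
  ∑ s, if A s then d s else 0

end

noncomputable section

namespace Stmt7

/-- the sharing function sh(x,y) = max{0, 1 − 2·||x|₁ − |y|₁|/n} -/
def sh {n : ℕ} (x y : BitString n) : ℝ :=
  max 0 (1 - 2 * |(onesCount x : ℝ) - (onesCount y : ℝ)| / n)

/-- the population fitness f(P) = Σ_{x∈P} f(x)/Σ_{y∈P} sh(x,y) -/
def popFit {n μ : ℕ} (Q : Fin μ → BitString n) : ℝ :=
  ∑ i, (twoMax (Q i) : ℝ) / ∑ j, sh (Q i) (Q j)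

/-- the candidate populations of size μ obtainable from P ∪ {y}: either remove the
offspring (`none`, keeping P) or remove the population member of index i
(`some i`, replacing it by y) -/
def candPop {n μ : ℕ} (P : Fin μ → BitString n) (y : BitString n) :
    Option (Fin μ) → Fin μ → BitString n
  | none => P
  | some i => Function.update P i y

/-- the candidate removals leading to a population of maximal population fitness -/
def bestSel {n μ : ℕ} (P : Fin μ → BitString n) (y : BitString n) :
    Finset (Option (Fin μ)) :=
  Finset.univ.filter fun j => ∀ j', popFit (candPop P y j') ≤ popFit (candPop P y j)

/-- State of a run: the current population together with flags recording whether 0ⁿ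
resp. 1ⁿ has been created (as an initial member or as an offspring). -/
abbrev State (n μ : ℕ) := (Fin μ → BitString n) × Bool × Bool

/-- One generation of the (μ+1) EA with population-level fitness sharing on TwoMax:
choose a parent uniformly at random, mutate it to obtain `y`, and replace the
population by a size-μ sub-multiset of P ∪ {y} maximizing the population fitness
(uniformly at random among the maximizers). -/
def trans (n μ : ℕ) : State n μ → State n μ → ℝ≥0∞ := fun s s' =>
  ∑ i : Fin μ, (μ : ℝ≥0∞)⁻¹ * ∑ y : BitString n, mutProb n (s.1 i) y *
    ∑ j ∈ bestSel s.1 y, ((bestSel s.1 y).card : ℝ≥0∞)⁻¹ *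
      (if s'.1 = candPop s.1 y j ∧
          s'.2.1 = (s.2.1 || decide (y = allZeros n)) ∧
          s'.2.2 = (s.2.2 || decide (y = allOnes n))
        then 1 else 0)

/-- Initialization: uniform over all populations of μ bit strings of length n. -/
def init (n μ : ℕ) : State n μ → ℝ≥0∞ := fun s =>
  ((2 : ℝ≥0∞) ^ (n * μ))⁻¹ *
    (if s.2.1 = decide (∃ i, s.1 i = allZeros n) ∧ s.2.2 = decide (∃ i, s.1 i = allOnes n)
      then 1 else 0)

/-- both optima have been created -/
def bothFound {n μ : ℕ} (s : State n μ) : Prop := s.2.1 = true ∧ s.2.2 = true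

/-- expected number of generations until both optima of TwoMax have been created -/
def expFindBoth (n μ : ℕ) : ℝ≥0∞ :=
  ∑' T : ℕ, probOf (evolve (init n μ) (trans n μ) T) fun s => ¬ bothFound s

def ff (t : ℝ) : ℝ := max t (1 - t)
def ss (u v : ℝ) : ℝ := max 0 (1 - 2 * |u - v|)

lemma ss_nonneg (u v : ℝ) : 0 ≤ ss u v := le_max_left _ _
lemma ss_self (u : ℝ) : ss u u = 1 := by simp [ss]
lemma ss_le_one (u v : ℝ) : ss u v ≤ 1 := by
  unfold ss
  have := abs_nonneg (u - v)
  exact max_le (by norm_num) (by linarith)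
lemma ss_comm (u v : ℝ) : ss u v = ss v u := by
  unfold ss; rw [abs_sub_comm]
lemma ss_mono {t0 t1 r : ℝ} (h : t0 ≤ t1) (h1 : t1 ≤ r) : ss t0 r ≤ ss t1 r := by
  unfold ss
  rw [abs_of_nonpos (by linarith), abs_of_nonpos (by linarith)]
  exact max_le_max le_rfl (by linarith)
lemma ss_lin {t r : ℝ} (h : 1/2 ≤ t) (h1 : t ≤ r) (h2 : r ≤ 1) : ss t r = 1 - 2 * (r - t) := by
  unfold ss
  rw [abs_of_nonpos (by linarith), max_eq_right (by linarith)]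
  ring

def Phi {ι : Type*} (R : Finset ι) (r : ι → ℝ) (t : ℝ) : ℝ :=
  ff t / (1 + ∑ j ∈ R, ss t (r j)) +
    ∑ k ∈ R, ff (r k) / (ss (r k) t + ∑ j ∈ R, ss (r k) (r j))

lemma ff_pos (t : ℝ) : 0 < ff t := by
  unfold ff
  rcases le_total t (1/2) with h | h
  · exact lt_max_of_lt_right (by linarith)
  · exact lt_max_of_lt_left (by linarith)

lemma D_ge {ι : Type*} (R : Finset ι) (r : ι → ℝ) {k : ι} (hk : k ∈ R) :
    1 ≤ ∑ j ∈ R, ss (r k) (r j) := by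
  have := Finset.single_le_sum (f := fun j => ss (r k) (r j)) (fun j _ => ss_nonneg _ _) hk
  simpa [ss_self] using this

lemma term_mono {ι : Type*} (R : Finset ι) (r : ι → ℝ) {t0 t1 : ℝ} (h : t0 ≤ t1)
    {k : ι} (hk : k ∈ R) (h1 : t1 ≤ r k) :
    ff (r k) / (ss (r k) t1 + ∑ j ∈ R, ss (r k) (r j)) ≤
    ff (r k) / (ss (r k) t0 + ∑ j ∈ R, ss (r k) (r j)) := by
  have h2 := D_ge R r hk
  have h3 := ss_nonneg (r k) t0
  apply div_le_div_of_nonneg_left (ff_pos _).le (by linarith)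
  have := ss_mono h h1
  rw [ss_comm (r k), ss_comm (r k) t1]
  linarith

lemma Phi_low {ι : Type*} (R : Finset ι) (r : ι → ℝ) {t0 t1 : ℝ} (h : t0 < t1)
    (h1 : ∀ k ∈ R, t1 ≤ r k) (hh : t1 ≤ 1/2) : Phi R r t1 < Phi R r t0 := by
  unfold Phi
  apply add_lt_add_of_lt_of_le
  · have a1 : ff t1 < ff t0 := by
      unfold ff
      rw [max_eq_right (by linarith), max_eq_right (by linarith)]; linarith
    have a2 : ∑ j ∈ R, ss t0 (r j) ≤ ∑ j ∈ R, ss t1 (r j) :=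
      Finset.sum_le_sum fun j hj => ss_mono h.le (h1 j hj)
    have a3 : 0 ≤ ∑ j ∈ R, ss t0 (r j) := Finset.sum_nonneg fun j _ => ss_nonneg _ _
    exact div_lt_div₀ a1 (by linarith) (ff_pos _).le (by linarith)
  · exact Finset.sum_le_sum fun k hk => term_mono R r h.le hk (h1 k hk)

lemma Phi_high {ι : Type*} (R : Finset ι) (r : ι → ℝ) {t0 t1 : ℝ} (h : t0 < t1)
    (h1 : ∀ k ∈ R, t1 ≤ r k) (h2 : ∀ k ∈ R, r k ≤ 1) (hh : 1/2 ≤ t0) (hR : R.Nonempty) :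
    Phi R r t1 < Phi R r t0 := by
  obtain ⟨k, hk⟩ := hR
  have hm : (1:ℝ) ≤ R.card := by
    exact_mod_cast Finset.card_pos.2 ⟨k, hk⟩
  set m : ℝ := (R.card : ℝ) with hmdef
  have e : ∀ t, 1/2 ≤ t → t ≤ t1 → ∑ j ∈ R, ss t (r j) = m - 2 * ∑ j ∈ R, r j + 2 * m * t := by
    intro t ht ht1
    rw [Finset.sum_congr rfl fun j hj => ss_lin ht (ht1.trans (h1 j hj)) (h2 j hj)]
    rw [Finset.sum_sub_distrib, ← Finset.mul_sum, Finset.sum_sub_distrib]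
    simp only [Finset.sum_const, nsmul_eq_mul, ← hmdef]
    ring
  have hS : m * t1 ≤ ∑ j ∈ R, r j := by
    have := Finset.card_nsmul_le_sum R r t1 h1
    simpa [hmdef] using this
  have hn0 : 0 ≤ ∑ j ∈ R, ss t0 (r j) := Finset.sum_nonneg fun j _ => ss_nonneg _ _
  have hn1 : 0 ≤ ∑ j ∈ R, ss t1 (r j) := Finset.sum_nonneg fun j _ => ss_nonneg _ _
  -- second part
  have hd : ∀ k' ∈ R, 0 ≤ ff (r k') / (ss (r k') t0 + ∑ j ∈ R, ss (r k') (r j)) -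
      ff (r k') / (ss (r k') t1 + ∑ j ∈ R, ss (r k') (r j)) := fun k' hk' =>
    sub_nonneg.2 (term_mono R r h.le hk' (h1 k' hk'))
  have hs := Finset.single_le_sum hd hk
  rw [Finset.sum_sub_distrib] at hs
  have key2 : (t1 - t0) / (1 + m)^2 < ff (r k) / (ss (r k) t0 + ∑ j ∈ R, ss (r k) (r j)) -
      ff (r k) / (ss (r k) t1 + ∑ j ∈ R, ss (r k) (r j)) := by
    have d1 := D_ge R r hk
    have d2 : ∑ j ∈ R, ss (r k) (r j) ≤ m := by
      have := Finset.sum_le_card_nsmul R (fun j => ss (r k) (r j)) 1 (fun j _ => ss_le_one _ _)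
      simpa [hmdef] using this
    have b0 := ss_nonneg (r k) t0
    have b1 := ss_nonneg (r k) t1
    have c0 := ss_le_one (r k) t0
    have c1 := ss_le_one (r k) t1
    have l : ss (r k) t1 - ss (r k) t0 = 2 * (t1 - t0) := by
      rw [ss_comm, ss_comm (r k) t0, ss_lin (by linarith) (h1 k hk) (h2 k hk),
        ss_lin hh (h.le.trans (h1 k hk)) (h2 k hk)]
      ring
    have hf : 1/2 < ff (r k) := lt_max_of_lt_left (by linarith [h1 k hk])
    generalize (∑ j ∈ R, ss (r k) (r j)) = D at *
    rw [div_sub_div _ _ (by linarith) (by linarith)]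
    have e1 : ff (r k) * (ss (r k) t1 + D) - (ss (r k) t0 + D) * ff (r k) =
      ff (r k) * (2 * (t1 - t0)) := by rw [← l]; ring
    rw [e1]
    apply div_lt_div₀ _ _ _ _
    · nlinarith
    · nlinarith
    · nlinarith
    · apply mul_pos <;> linarith
  have key1 : ff t1 / (1 + ∑ j ∈ R, ss t1 (r j)) - ff t0 / (1 + ∑ j ∈ R, ss t0 (r j)) ≤
      (t1 - t0) / (1 + m)^2 := by
    have e0 := e t0 hh h.le
    have e1 := e t1 (by linarith) le_rfl
    have f0 : ff t0 = t0 := max_eq_left (by linarith)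
    have f1 : ff t1 = t1 := max_eq_left (by linarith)
    rw [f0, f1]
    set S := ∑ j ∈ R, r j
    obtain ⟨A, hA⟩ : ∃ A, A = 1 + m - 2 * S := ⟨_, rfl⟩
    have g0 : 1 + ∑ j ∈ R, ss t0 (r j) = A + 2 * m * t0 := by rw [e0, hA]; ring
    have g1 : 1 + ∑ j ∈ R, ss t1 (r j) = A + 2 * m * t1 := by rw [e1, hA]; ring
    have p0 : 0 < A + 2 * m * t0 := by rw [← g0]; linarith
    have p1 : 0 < A + 2 * m * t1 := by rw [← g1]; linarith
    rw [g0, g1, div_sub_div _ _ p1.ne' p0.ne']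
    have e1 : t1 * (A + 2 * m * t0) - (A + 2 * m * t1) * t0 = A * (t1 - t0) := by ring
    rw [e1]
    have hA1 : A ≤ 1 := by nlinarith
    have q0 : A + m ≤ A + 2 * m * t0 := by nlinarith
    have q1 : A + m ≤ A + 2 * m * t1 := by nlinarith
    rcases le_or_gt A 0 with h0 | h0
    · refine le_trans (b := 0) ?_ (by apply div_nonneg; linarith; positivity)
      apply div_nonpos_of_nonpos_of_nonneg
      · nlinarith
      · positivity
    · rw [div_le_div_iff₀ (by positivity) (by positivity)]
      have : A * (1+m)^2 ≤ (A + m)^2 := by nlinarith [mul_nonneg (sub_nonneg.2 hA1) (by nlinarith : 0 ≤ m^2 - A)]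
      have r1 : (A + m)^2 ≤ (A + 2 * m * t1) * (A + 2 * m * t0) := by
        rw [sq]; exact mul_le_mul q1 q0 (by positivity) (by positivity)
      nlinarith
  unfold Phi
  linarith

lemma Phi_lt {ι : Type*} (R : Finset ι) (r : ι → ℝ) {t0 t1 : ℝ} (h : t0 < t1)
    (h1 : ∀ k ∈ R, t1 ≤ r k) (h2 : ∀ k ∈ R, r k ≤ 1) (hR : R.Nonempty) :
    Phi R r t1 < Phi R r t0 := by
  rcases le_or_gt t1 (1/2) with a | a
  · exact Phi_low R r h h1 a
  rcases le_or_gt (1/2) t0 with b | b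
  · exact Phi_high R r h h1 h2 b hR
  · exact (Phi_high R r a h1 h2 le_rfl hR).trans
      (Phi_low R r b (fun k hk => a.le.trans (h1 k hk)) le_rfl)

def FF {μ : ℕ} (a : Fin μ → ℝ) : ℝ := ∑ i, ff (a i) / ∑ j, ss (a i) (a j)

lemma FF_update {μ : ℕ} (a : Fin μ → ℝ) (i : Fin μ) (t : ℝ) :
    FF (Function.update a i t) = Phi (Finset.univ.erase i) a t := by
  have H : ∀ u, ∑ j, ss u (Function.update a i t j) =
      ss u t + ∑ j ∈ Finset.univ.erase i, ss u (a j) := by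
    intro u
    rw [← Finset.add_sum_erase _ _ (Finset.mem_univ i)]
    congr 1
    · simp
    · apply Finset.sum_congr rfl
      intro j hj
      rw [Function.update_of_ne (Finset.ne_of_mem_erase hj)]
  unfold FF Phi
  rw [← Finset.add_sum_erase _ _ (Finset.mem_univ i)]
  simp only [H]
  congr 1
  · simp [ss_self]
  · apply Finset.sum_congr rfl
    intro j hj
    rw [Function.update_of_ne (Finset.ne_of_mem_erase hj)]

lemma FF_lt {μ : ℕ} (hμ : 2 ≤ μ) (a : Fin μ → ℝ) (i : Fin μ) (t : ℝ) (ht : t < a i)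
    (h1 : ∀ k, a i ≤ a k) (h2 : ∀ k, a k ≤ 1) : FF a < FF (Function.update a i t) := by
  have : FF a = FF (Function.update a i (a i)) := by simp
  rw [this, FF_update, FF_update]
  apply Phi_lt _ _ ht (fun k _ => h1 k) (fun k _ => h2 k)
  rw [← Finset.card_pos, Finset.card_erase_of_mem (Finset.mem_univ i)]
  simp; omega

def cnt {n : ℕ} (b : Bool) (x : BitString n) : ℕ := (Finset.univ.filter fun i => x i = b).card

lemma cnt_le {n : ℕ} (b : Bool) (x : BitString n) : cnt b x ≤ n := by
  unfold cnt
  exact (Finset.card_le_univ _).trans (by simp)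

lemma cnt_true {n : ℕ} (x : BitString n) : cnt true x = onesCount x := by
  unfold cnt onesCount; congr

lemma cnt_false {n : ℕ} (x : BitString n) : cnt false x + onesCount x = n := by
  rw [← cnt_true]
  unfold cnt
  have := Finset.card_filter_add_card_filter_not (s := (Finset.univ : Finset (Fin n))) (fun i => x i = false)
  simpa using this

lemma popFit_eq {n μ : ℕ} (hn : 0 < n) (b : Bool) (Q : Fin μ → BitString n) :
    popFit Q = n * FF (fun i => (cnt b (Q i) : ℝ) / n) := by
  have hn' : (0:ℝ) < n := by exact_mod_cast hn
  have h1 : ∀ x : BitString n, (twoMax x : ℝ) = n * ff ((cnt b x : ℝ) / n) := by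
    intro x
    unfold ff twoMax
    rw [mul_max_of_nonneg _ _ hn'.le]
    have e1 : (n:ℝ) * ((cnt b x : ℝ) / n) = cnt b x := by field_simp
    have e2 : (n:ℝ) * (1 - (cnt b x : ℝ) / n) = n - cnt b x := by field_simp
    rw [e1, e2]
    have hf := cnt_false x
    have hf' : (cnt false x : ℝ) + onesCount x = n := by exact_mod_cast hf
    have hle : onesCount x ≤ n := by omega
    push_cast [Nat.cast_sub hle]
    cases b
    · rw [max_comm]; congr 1 <;> linarith
    · rw [cnt_true]
  have h2 : ∀ x y : BitString n, sh x y = ss ((cnt b x : ℝ) / n) ((cnt b y : ℝ) / n) := by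
    intro x y
    unfold sh ss
    have : |(cnt b x : ℝ) / n - (cnt b y : ℝ) / n| = |(onesCount x : ℝ) - onesCount y| / n := by
      rw [← sub_div, abs_div, abs_of_pos hn']
      congr 1
      have hx : (cnt false x : ℝ) + onesCount x = n := by exact_mod_cast cnt_false x
      have hy : (cnt false y : ℝ) + onesCount y = n := by exact_mod_cast cnt_false y
      cases b
      · rw [abs_sub_comm]; congr 1; linarith
      · simp only [cnt_true]
    rw [this]; congr 2; ring
  unfold popFit FF
  rw [Finset.mul_sum]
  simp only [h1, h2, mul_div_assoc]

lemma popFit_perm {n μ : ℕ} (Q : Fin μ → BitString n) (e : Equiv.Perm (Fin μ)) :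
    popFit (fun i => Q (e i)) = popFit Q := by
  unfold popFit
  rw [← Equiv.sum_comp e (fun i => (twoMax (Q i) : ℝ) / ∑ j, sh (Q i) (Q j))]
  apply Finset.sum_congr rfl
  intro i _
  rw [← Equiv.sum_comp e (fun j => sh (Q (e i)) (Q j))]

lemma popFit_lt {n μ : ℕ} (hn : 0 < n) (hμ : 2 ≤ μ) (b : Bool) (Q : Fin μ → BitString n)
    (k : Fin μ) (z : BitString n) (hz : cnt b z < cnt b (Q k))
    (hk : ∀ l, cnt b (Q k) ≤ cnt b (Q l)) : popFit Q < popFit (Function.update Q k z) := by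
  have hn' : (0:ℝ) < n := by exact_mod_cast hn
  rw [popFit_eq hn b, popFit_eq hn b]
  apply mul_lt_mul_of_pos_left _ hn'
  have e : (fun i => (cnt b (Function.update Q k z i) : ℝ) / n) =
      Function.update (fun i => (cnt b (Q i) : ℝ) / n) k ((cnt b z : ℝ) / n) := by
    funext i
    by_cases h : i = k
    · subst h; simp
    · simp [Function.update_of_ne h]
  rw [e]
  apply FF_lt hμ
  · have : (cnt b z : ℝ) < cnt b (Q k) := by exact_mod_cast hz
    gcongr
  · intro l
    have : (cnt b (Q k) : ℝ) ≤ cnt b (Q l) := by exact_mod_cast hk l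
    gcongr
  · intro l
    have : (cnt b (Q l) : ℝ) ≤ n := by exact_mod_cast cnt_le b (Q l)
    exact div_le_one_of_le₀ this hn'.le

def mn {n μ : ℕ} (b : Bool) (P : Fin μ → BitString n) : ℕ := ⨅ i, cnt b (P i)

lemma mn_le {n μ : ℕ} (b : Bool) (P : Fin μ → BitString n) (i : Fin μ) :
    mn b P ≤ cnt b (P i) := ciInf_le (OrderBot.bddBelow _) i

lemma exists_mn {n μ : ℕ} (hμ : 2 ≤ μ) (b : Bool) (P : Fin μ → BitString n) :
    ∃ i, cnt b (P i) = mn b P := by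
  have : Nonempty (Fin μ) := ⟨⟨0, by omega⟩⟩
  exact Nat.sInf_mem (Set.range_nonempty (fun i => cnt b (P i)))

/-- no better candidate -/
lemma sel_aux {n μ : ℕ} (hn : 0 < n) (hμ : 2 ≤ μ) (b : Bool) (Q : Fin μ → BitString n)
    (z : BitString n) (h : ∀ k, popFit (Function.update Q k z) ≤ popFit Q) :
    mn b Q ≤ cnt b z := by
  by_contra hc
  push Not at hc
  obtain ⟨k, hk⟩ := exists_mn hμ b Q
  have := popFit_lt hn hμ b Q k z (by omega) (fun l => hk ▸ mn_le b Q l)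
  exact absurd (h k) (not_le.2 this)

lemma sel {n μ : ℕ} (hn : 0 < n) (hμ : 2 ≤ μ) (b : Bool) (P : Fin μ → BitString n)
    (y : BitString n) (j : Option (Fin μ)) (hj : j ∈ bestSel P y) :
    mn b (candPop P y j) ≤ mn b P ∧ mn b (candPop P y j) ≤ cnt b y := by
  have hj' : ∀ j', popFit (candPop P y j') ≤ popFit (candPop P y j) := by
    simpa [bestSel] using hj
  cases j with
  | none => exact ⟨le_rfl, sel_aux hn hμ b P y fun k => hj' (some k)⟩
  | some i =>
    have hy : mn b (candPop P y (some i)) ≤ cnt b y := by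
      have := mn_le b (candPop P y (some i)) i
      simpa [candPop] using this
    have hz : mn b (candPop P y (some i)) ≤ cnt b (P i) := by
      apply sel_aux hn hμ
      intro k
      by_cases hki : k = i
      · subst hki
        have := hj' none
        simpa [candPop] using this
      · have := hj' (some k)
        refine le_trans (le_of_eq ?_) this
        rw [← popFit_perm (candPop P y (some k)) (Equiv.swap i k)]
        congr 1
        funext l
        simp only [candPop]
        by_cases h1 : l = k
        · subst h1
          simp [Function.update_of_ne (Ne.symm hki)]
        · by_cases h2 : l = i
          · subst h2
            simp [Function.update_of_ne h1]
          · rw [Equiv.swap_apply_of_ne_of_ne h2 h1]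
            simp [Function.update_of_ne h1, Function.update_of_ne h2]
    refine ⟨?_, hy⟩
    obtain ⟨l, hl⟩ := exists_mn hμ b P
    rw [← hl]
    by_cases h2 : l = i
    · rw [h2]; exact hz
    · have := mn_le b (candPop P y (some i)) l
      simpa [candPop, Function.update_of_ne h2] using this

lemma mutProb_prod {n : ℕ} (x y : BitString n) :
    mutProb n x y = ∏ i, (if x i ≠ y i then (n : ℝ≥0∞)⁻¹ else 1 - (n : ℝ≥0∞)⁻¹) := by
  rw [Finset.prod_ite, Finset.prod_const, Finset.prod_const]
  unfold mutProb
  have h1 : hammingDist x y = (Finset.univ.filter fun i => x i ≠ y i).card := by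
    unfold hammingDist; congr
  have h2 := Finset.card_filter_add_card_filter_not (s := (Finset.univ : Finset (Fin n))) (fun i => x i ≠ y i)
  rw [Finset.card_univ, Fintype.card_fin] at h2
  rw [h1]
  congr 2
  omega

lemma mutProb_sum {n : ℕ} (hn : 0 < n) (x : BitString n) : ∑ y, mutProb n x y = 1 := by
  have hp : (n : ℝ≥0∞)⁻¹ ≤ 1 := by
    rw [ENNReal.inv_le_one]; exact_mod_cast hn
  simp only [mutProb_prod]
  have := Finset.prod_univ_sum (fun _ : Fin n => (Finset.univ : Finset Bool))
    (fun i c => if x i ≠ c then (n : ℝ≥0∞)⁻¹ else 1 - (n : ℝ≥0∞)⁻¹)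
  rw [Fintype.piFinset_univ] at this
  rw [← this]
  apply Finset.prod_eq_one
  intro i _
  rw [Fintype.sum_bool]
  cases x i
  · simp [add_tsub_cancel_of_le hp]
  · simp [tsub_add_cancel_of_le hp]

lemma pow_bound {n : ℕ} (hn : 2 ≤ n) : (16 : ℝ≥0∞)⁻¹ ≤ (1 - (n : ℝ≥0∞)⁻¹) ^ n := by
  have hn' : (2:ℝ) ≤ n := by exact_mod_cast hn
  have hi : ((n:ℝ))⁻¹ ≤ 1/2 := by
    rw [inv_le_comm₀ (by linarith) (by norm_num)]; linarith
  have e : (1 - (n : ℝ≥0∞)⁻¹) = ENNReal.ofReal (1 - (n:ℝ)⁻¹) := by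
    rw [ENNReal.ofReal_sub _ (by positivity), ENNReal.ofReal_inv_of_pos (by linarith)]
    simp
  rw [e, ← ENNReal.ofReal_pow (by linarith)]
  have e2 : (16 : ℝ≥0∞)⁻¹ = ENNReal.ofReal ((16:ℝ)⁻¹) := by
    rw [ENNReal.ofReal_inv_of_pos (by norm_num)]; simp
  rw [e2]
  apply ENNReal.ofReal_le_ofReal
  obtain ⟨m, hm1, hm2⟩ : ∃ m : ℕ, n ≤ 2 * m ∧ 4 * m ≤ 3 * n := ⟨(n+1)/2, by omega, by omega⟩
  have hm2' : (4:ℝ) * m ≤ 3 * n := by exact_mod_cast hm2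
  have b := one_add_mul_le_pow (a := -(n:ℝ)⁻¹) (by linarith) m
  have b2 : (1:ℝ)/4 ≤ 1 + m * (-(n:ℝ)⁻¹) := by
    have : (m:ℝ) * (n:ℝ)⁻¹ ≤ 3/4 := by
      rw [← div_eq_mul_inv, div_le_iff₀ (by linarith)]; linarith
    linarith
  have b3 : (1:ℝ)/4 ≤ (1 - (n:ℝ)⁻¹)^m := by
    rw [sub_eq_add_neg]; linarith
  calc (16:ℝ)⁻¹ = (1/4)^2 := by norm_num
    _ ≤ ((1 - (n:ℝ)⁻¹)^m)^2 := by gcongr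
    _ = (1 - (n:ℝ)⁻¹)^(2*m) := by rw [← pow_mul, mul_comm]
    _ ≤ _ := pow_le_pow_of_le_one (by linarith) (by linarith [inv_nonneg.2 (by linarith : (0:ℝ) ≤ n)]) hm1

lemma mutProb_self {n : ℕ} (hn : 2 ≤ n) (x : BitString n) : (16 : ℝ≥0∞)⁻¹ ≤ mutProb n x x := by
  unfold mutProb
  simpa using pow_bound hn

lemma mutProb_flip {n : ℕ} (hn : 2 ≤ n) (x : BitString n) (i : Fin n) (c : Bool) (hc : x i ≠ c) :
    (n : ℝ≥0∞)⁻¹ * (16 : ℝ≥0∞)⁻¹ ≤ mutProb n x (Function.update x i c) := by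
  have h : hammingDist x (Function.update x i c) = 1 := by
    unfold hammingDist
    rw [Finset.card_eq_one]
    refine ⟨i, ?_⟩
    ext j
    by_cases h : j = i
    · subst h; simpa using hc
    · simp [h]
  unfold mutProb
  rw [h, pow_one]
  gcongr
  refine (pow_bound hn).trans ?_
  exact pow_le_pow_of_le_one (by simp) tsub_le_self (by omega)

lemma cnt_flip {n : ℕ} (x : BitString n) (i : Fin n) (b : Bool) (h : x i = b) :
    cnt b (Function.update x i (!b)) + 1 = cnt b x := by
  unfold cnt
  have : (Finset.univ.filter fun j => Function.update x i (!b) j = b) =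
      (Finset.univ.filter fun j => x j = b).erase i := by
    ext j
    by_cases h : j = i
    · subst h; simp
    · simp [h]
  rw [this]
  exact Finset.card_erase_add_one (by simpa using h)

lemma cnt_zero {n : ℕ} (x : BitString n) (b : Bool) (h : cnt b x = 0) : x = fun _ => !b := by
  funext i
  unfold cnt at h
  rw [Finset.card_eq_zero, Finset.filter_eq_empty_iff] at h
  have := h (Finset.mem_univ i)
  cases b <;> simpa using this

/-- potential -/
def G (c : ℝ≥0∞) (k : ℕ) : ℝ≥0∞ := c * (1 + ∑ j ∈ Finset.range k, ((j + 1 : ℕ) : ℝ≥0∞)⁻¹)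

lemma G_succ (c : ℝ≥0∞) (k : ℕ) : G c (k+1) = G c k + c * ((k + 1 : ℕ) : ℝ≥0∞)⁻¹ := by
  unfold G
  rw [Finset.sum_range_succ, ← add_assoc, mul_add]

lemma G_mono (c : ℝ≥0∞) : Monotone (G c) :=
  monotone_nat_of_le_succ fun k => by rw [G_succ]; exact le_self_add

/-- expectation of a function of parent, offspring, choice -/
def EE {n μ : ℕ} (P : Fin μ → BitString n) (u : Fin μ → BitString n → Option (Fin μ) → ℝ≥0∞) : ℝ≥0∞ :=
  ∑ i : Fin μ, (μ : ℝ≥0∞)⁻¹ * ∑ y : BitString n, mutProb n (P i) y *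
    ∑ j ∈ bestSel P y, ((bestSel P y).card : ℝ≥0∞)⁻¹ * u i y j

def nxt {n μ : ℕ} (s : State n μ) (y : BitString n) (j : Option (Fin μ)) : State n μ :=
  (candPop s.1 y j, (s.2.1 || decide (y = allZeros n)), (s.2.2 || decide (y = allOnes n)))

lemma EE_trans {n μ : ℕ} (s : State n μ) (h : State n μ → ℝ≥0∞) :
    ∑ s', trans n μ s s' * h s' = EE s.1 (fun _ y j => h (nxt s y j)) := by
  unfold trans EE
  simp only [Finset.sum_mul, Finset.mul_sum]
  rw [Finset.sum_comm]
  apply Finset.sum_congr rfl; intro i _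
  rw [Finset.sum_comm]
  apply Finset.sum_congr rfl; intro y _
  rw [Finset.sum_comm]
  apply Finset.sum_congr rfl; intro j _
  rw [Finset.sum_eq_single (nxt s y j)]
  · simp [nxt]; ring
  · intro s' _ hs'
    rw [if_neg]
    · simp
    · rintro ⟨h1, h2, h3⟩
      apply hs'
      exact Prod.ext h1 (Prod.ext h2 h3)
  · simp

lemma EE_add {n μ : ℕ} (P : Fin μ → BitString n) (u v) : 
    EE P (fun i y j => u i y j + v i y j) = EE P u + EE P v := by
  unfold EE
  simp only [mul_add, Finset.sum_add_distrib]

lemma bestSel_nonempty {n μ : ℕ} (P : Fin μ → BitString n) (y : BitString n) :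
    (bestSel P y).Nonempty := by
  obtain ⟨j, _, hj⟩ := Finset.exists_max_image (Finset.univ : Finset (Option (Fin μ)))
    (fun j => popFit (candPop P y j)) ⟨none, Finset.mem_univ _⟩
  exact ⟨j, by simpa [bestSel] using hj⟩

lemma inner_const {n μ : ℕ} (P : Fin μ → BitString n) (y : BitString n) (c : ℝ≥0∞) :
    ∑ _j ∈ bestSel P y, ((bestSel P y).card : ℝ≥0∞)⁻¹ * c = c := by
  have h := (bestSel_nonempty P y).card_pos
  rw [Finset.sum_const, nsmul_eq_mul, ← mul_assoc, ENNReal.mul_inv_cancel, one_mul]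
  · exact_mod_cast h.ne'
  · exact ENNReal.natCast_ne_top _

lemma EE_const {n μ : ℕ} (hn : 0 < n) (hμ : 2 ≤ μ) (P : Fin μ → BitString n) (c : ℝ≥0∞) :
    EE P (fun _ _ _ => c) = c := by
  unfold EE
  simp only [inner_const]
  simp only [← Finset.sum_mul, mutProb_sum hn, one_mul]
  rw [Finset.sum_const, nsmul_eq_mul, Finset.card_univ, Fintype.card_fin,
    ENNReal.mul_inv_cancel, one_mul]
  · exact_mod_cast (by omega : μ ≠ 0)
  · exact ENNReal.natCast_ne_top _

lemma EE_mono {n μ : ℕ} (P : Fin μ → BitString n) (u v : Fin μ → BitString n → Option (Fin μ) → ℝ≥0∞)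
    (h : ∀ i y, ∀ j ∈ bestSel P y, u i y j ≤ v i y j) : EE P u ≤ EE P v := by
  unfold EE
  gcongr with i _ y _ j hj
  exact h i y j hj

lemma EE_drop {n μ : ℕ} (P : Fin μ → BitString n) (i0 : Fin μ) (Y : Finset (BitString n)) (d q : ℝ≥0∞)
    (hq : ∀ y ∈ Y, q ≤ mutProb n (P i0) y) :
    (μ : ℝ≥0∞)⁻¹ * (Y.card * (q * d)) ≤ EE P (fun i y _ => if i = i0 ∧ y ∈ Y then d else 0) := by
  unfold EE
  simp only [inner_const]
  refine le_trans ?_ (Finset.single_le_sum (fun _ _ => zero_le) (Finset.mem_univ i0))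
  gcongr
  simp only [true_and, mul_ite, mul_zero]
  rw [← Finset.sum_filter]
  rw [Finset.filter_mem_eq_inter, Finset.univ_inter, ← nsmul_eq_mul]
  apply Finset.card_nsmul_le_sum
  intro y hy
  gcongr
  exact hq y hy

def flag {n μ : ℕ} (b : Bool) (s : State n μ) : Bool := if b then s.2.1 else s.2.2

def g {n μ : ℕ} (b : Bool) (s : State n μ) : ℝ≥0∞ :=
  if flag b s then 0 else G (16 * μ * n) (mn b s.1)

lemma flag_nxt {n μ : ℕ} (b : Bool) (s : State n μ) (y j) :
    flag b (nxt s y j) = (flag b s || decide (y = fun _ => !b)) := by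
  cases b <;> simp [flag, nxt, allZeros, allOnes] <;> rfl

lemma g_nxt {n μ : ℕ} (hn : 0 < n) (hμ : 2 ≤ μ) (b : Bool) (s : State n μ) (y : BitString n)
    (j) (hj : j ∈ bestSel s.1 y) : g b (nxt s y j) ≤ g b s := by
  unfold g
  rw [flag_nxt]
  by_cases h : flag b s
  · simp [h]
  · rw [if_neg h]
    split_ifs
    · exact zero_le
    · exact G_mono _ (sel hn hμ b s.1 y j hj).1

lemma drift {n μ : ℕ} (hn : 2 ≤ n) (hμ : 2 ≤ μ) (b : Bool) (s : State n μ) :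
    EE s.1 (fun _ y j => g b (nxt s y j)) + (if flag b s then 0 else 1) ≤ g b s := by
  have hn0 : 0 < n := by omega
  have hnn : (n : ℝ≥0∞) ≠ 0 := by exact_mod_cast hn0.ne'
  have hnt : (n : ℝ≥0∞) ≠ ⊤ := ENNReal.natCast_ne_top _
  have hm0 : (μ : ℝ≥0∞) ≠ 0 := by exact_mod_cast (by omega : μ ≠ 0)
  have hmt : (μ : ℝ≥0∞) ≠ ⊤ := ENNReal.natCast_ne_top _
  by_cases hf : flag b s
  · simp only [hf, if_true, add_zero]
    refine (EE_mono _ _ (fun _ _ _ => g b s) fun i y j hj => g_nxt hn0 hμ b s y j hj).trans ?_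
    rw [EE_const hn0 hμ]
  · rw [if_neg hf]
    suffices ∃ (i0 : Fin μ) (Y : Finset (BitString n)) (d : ℝ≥0∞),
        1 ≤ EE s.1 (fun i y _ => if i = i0 ∧ y ∈ Y then d else 0) ∧
        ∀ y ∈ Y, ∀ j ∈ bestSel s.1 y, g b (nxt s y j) + d ≤ g b s by
      obtain ⟨i0, Y, d, h1, h2⟩ := this
      calc _ ≤ EE s.1 (fun _ y j => g b (nxt s y j)) +
            EE s.1 (fun i y _ => if i = i0 ∧ y ∈ Y then d else 0) := by gcongr
        _ = EE s.1 (fun i y j => g b (nxt s y j) + if i = i0 ∧ y ∈ Y then d else 0) :=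
            (EE_add _ _ _).symm
        _ ≤ EE s.1 (fun _ _ _ => g b s) := by
            apply EE_mono
            intro i y j hj
            split_ifs with h
            · exact h2 y h.2 j hj
            · rw [add_zero]; exact g_nxt hn0 hμ b s y j hj
        _ = g b s := EE_const hn0 hμ _ _
    obtain ⟨i0, hi0⟩ := exists_mn hμ b s.1
    have hg : g b s = G (16 * μ * n) (mn b s.1) := by unfold g; rw [if_neg hf]
    rcases hk : mn b s.1 with _ | k
    · refine ⟨i0, {s.1 i0}, 16 * μ * n, ?_, ?_⟩
      · refine le_trans ?_ (EE_drop s.1 i0 {s.1 i0} _ (16⁻¹) ?_)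
        · rw [Finset.card_singleton, Nat.cast_one, one_mul]
          have : (μ : ℝ≥0∞)⁻¹ * (16⁻¹ * (16 * μ * n)) =
            ((μ : ℝ≥0∞)⁻¹ * μ) * (16⁻¹ * 16) * n := by ring
          rw [this, ENNReal.inv_mul_cancel hm0 hmt, ENNReal.inv_mul_cancel (by norm_num) (by norm_num)]
          simp only [one_mul]
          exact_mod_cast hn0
        · intro y hy
          rw [Finset.mem_singleton] at hy
          rw [hy]; exact mutProb_self hn _
      · intro y hy j hj
        rw [Finset.mem_singleton] at hy
        have : y = fun _ => !b := cnt_zero y b (by rw [hy, hi0, hk])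
        have h0 : g b (nxt s y j) = 0 := by
          unfold g; rw [flag_nxt]; simp [this]
        rw [h0, hg, hk, zero_add]
        simp [G]
    · set I := Finset.univ.filter fun i => s.1 i0 i = b with hI
      have hcard : I.card = k + 1 := by rw [← hk, ← hi0]; rfl
      set Y := I.image (fun i => Function.update (s.1 i0) i (!b)) with hY
      have hYc : Y.card = k + 1 := by
        rw [hY, Finset.card_image_of_injOn, hcard]
        intro i hi i' hi' he
        by_contra hne
        have e := congrFun he i
        simp only [Function.update_self, Function.update_of_ne hne] at e
        have : s.1 i0 i = b := by simpa [hI] using hi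
        rw [this] at e
        cases b <;> simp at e
      refine ⟨i0, Y, 16 * μ * n * ((k + 1 : ℕ) : ℝ≥0∞)⁻¹, ?_, ?_⟩
      · refine le_trans ?_ (EE_drop s.1 i0 Y _ ((n : ℝ≥0∞)⁻¹ * 16⁻¹) ?_)
        · rw [hYc]
          have : (μ : ℝ≥0∞)⁻¹ * (((k + 1 : ℕ) : ℝ≥0∞) * ((n : ℝ≥0∞)⁻¹ * 16⁻¹ *
              (16 * μ * n * ((k + 1 : ℕ) : ℝ≥0∞)⁻¹))) =
            ((μ : ℝ≥0∞)⁻¹ * μ) * (16⁻¹ * 16) * ((n : ℝ≥0∞)⁻¹ * n) *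
              (((k + 1 : ℕ) : ℝ≥0∞)⁻¹ * ((k + 1 : ℕ) : ℝ≥0∞)) := by ring
          rw [this, ENNReal.inv_mul_cancel hm0 hmt, ENNReal.inv_mul_cancel (by norm_num) (by norm_num),
            ENNReal.inv_mul_cancel hnn hnt,
            ENNReal.inv_mul_cancel (by exact_mod_cast k.succ_ne_zero) (ENNReal.natCast_ne_top _)]
          simp
        · intro y hy
          obtain ⟨i, hi, rfl⟩ := Finset.mem_image.1 hy
          have : s.1 i0 i = b := by simpa [hI] using hi
          exact mutProb_flip hn _ _ _ (by rw [this]; cases b <;> simp)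
      · intro y hy j hj
        obtain ⟨i, hi, rfl⟩ := Finset.mem_image.1 hy
        have hb : s.1 i0 i = b := by simpa [hI] using hi
        have hc := cnt_flip (s.1 i0) i b hb
        have hs := (sel hn0 hμ b s.1 _ j hj).2
        rw [hg, hk, G_succ]
        gcongr
        unfold g
        split_ifs
        · exact zero_le
        · apply G_mono
          simp only [nxt]
          omega

lemma hit_bound {S : Type*} [Fintype S] (ini : S → ℝ≥0∞) (tr : S → S → ℝ≥0∞) (A : S → Prop)
    (h : S → ℝ≥0∞) (hd : ∀ s, ∑ s', tr s s' * h s' + (if A s then 1 else 0) ≤ h s) :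
    ∑' T : ℕ, probOf (evolve ini tr T) A ≤ ∑ s, ini s * h s := by
  have step : ∀ T, ∑ s, evolve ini tr (T+1) s * h s + probOf (evolve ini tr T) A ≤
      ∑ s, evolve ini tr T s * h s := by
    intro T
    have e : ∑ s, evolve ini tr (T+1) s * h s =
        ∑ s, evolve ini tr T s * ∑ s', tr s s' * h s' := by
      simp only [evolve, Finset.sum_mul, Finset.mul_sum]
      rw [Finset.sum_comm]
      simp only [mul_assoc]
    rw [e]
    unfold probOf
    rw [← Finset.sum_add_distrib]
    apply Finset.sum_le_sum
    intro s _
    refine le_trans (le_of_eq ?_) (mul_le_mul_right (hd s) (evolve ini tr T s))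
    split_ifs <;> simp [mul_add]
  have part : ∀ N, ∑ s, evolve ini tr N s * h s + ∑ T ∈ Finset.range N, probOf (evolve ini tr T) A ≤
      ∑ s, ini s * h s := by
    intro N
    induction N with
    | zero => simp [evolve]
    | succ N ih =>
      rw [Finset.sum_range_succ]
      refine le_trans ?_ ih
      rw [add_comm (∑ T ∈ Finset.range N, _), ← add_assoc]
      gcongr
      exact step N
  rw [ENNReal.tsum_eq_iSup_nat]
  exact iSup_le fun N => le_add_self.trans (part N)

lemma init_sum (n μ : ℕ) : ∑ s, init n μ s ≤ 1 := by
  unfold init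
  rw [← Finset.mul_sum, Fintype.sum_prod_type]
  have : ∀ P : Fin μ → BitString n, (∑ q : Bool × Bool, 
      if q.1 = decide (∃ i, P i = allZeros n) ∧ q.2 = decide (∃ i, P i = allOnes n)
      then (1 : ℝ≥0∞) else 0) = 1 := by
    intro P
    rw [Finset.sum_eq_single (decide (∃ i, P i = allZeros n), decide (∃ i, P i = allOnes n))]
    · simp
    · intro q _ hq
      rw [if_neg]
      rintro ⟨h1, h2⟩
      exact hq (Prod.ext h1 h2)
    · simp
  simp only [this]
  simp only [Finset.sum_const, Finset.card_univ, nsmul_eq_mul, mul_one]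
  simp only [Fintype.card_pi, Fintype.card_bool, Finset.prod_const, Finset.card_univ, Fintype.card_fin,
    Nat.cast_pow, Nat.cast_ofNat, ← pow_mul]
  exact ENNReal.inv_mul_le_one _

lemma G_le {n : ℕ} (c : ℝ) (hc : 0 ≤ c) {k : ℕ} (hk : k ≤ n) :
    G (ENNReal.ofReal c) k ≤ ENNReal.ofReal (c * (2 + Real.log n)) := by
  refine (G_mono _ hk).trans ?_
  have hs : ∑ j ∈ Finset.range n, ((j + 1 : ℕ) : ℝ≥0∞)⁻¹ =
      ENNReal.ofReal (∑ j ∈ Finset.range n, ((j + 1 : ℕ) : ℝ)⁻¹) := by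
    rw [ENNReal.ofReal_sum_of_nonneg (fun _ _ => by positivity)]
    apply Finset.sum_congr rfl
    intro j _
    rw [ENNReal.ofReal_inv_of_pos (by positivity), ENNReal.ofReal_natCast]
  unfold G
  rw [hs, ← ENNReal.ofReal_one, ← ENNReal.ofReal_add (by norm_num) (Finset.sum_nonneg fun _ _ => by positivity),
    ← ENNReal.ofReal_mul hc]
  apply ENNReal.ofReal_le_ofReal
  apply mul_le_mul_of_nonneg_left _ hc
  have := harmonic_le_one_add_log n
  simp only [harmonic, Rat.cast_sum, Rat.cast_inv, Rat.cast_natCast] at this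
  linarith

lemma main_bound {n μ : ℕ} (hn : 2 ≤ n) (hμ : 2 ≤ μ) :
    expFindBoth n μ ≤ ENNReal.ofReal (2 * (16 * μ * n * (2 + Real.log n))) := by
  have hl : 0 ≤ Real.log n := Real.log_natCast_nonneg n
  have hd : ∀ s : State n μ, ∑ s', trans n μ s s' * (g true s' + g false s') +
      (if ¬ bothFound s then 1 else 0) ≤ g true s + g false s := by
    intro s
    rw [EE_trans s (fun s' => g true s' + g false s'), EE_add]
    refine le_trans ?_ (add_le_add (drift hn hμ true s) (drift hn hμ false s))
    rw [add_add_add_comm]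
    gcongr
    unfold bothFound flag
    rcases s with ⟨P, _ | _, _ | _⟩ <;> simp
  refine (hit_bound (init n μ) (trans n μ) (fun s => ¬ bothFound s)
    (fun s => g true s + g false s) (fun s => by convert hd s)).trans ?_
  have hb : ∀ s : State n μ, g true s + g false s ≤
      ENNReal.ofReal (2 * (16 * μ * n * (2 + Real.log n))) := by
    intro s
    rw [two_mul, ENNReal.ofReal_add (by positivity) (by positivity)]
    have hc : (16 * μ * n : ℝ≥0∞) = ENNReal.ofReal (16 * μ * n) := by
      rw [ENNReal.ofReal_mul (by positivity), ENNReal.ofReal_mul (by positivity)]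
      simp
    have : ∀ b, g b s ≤ ENNReal.ofReal (16 * μ * n * (2 + Real.log n)) := by
      intro b
      unfold g
      split_ifs
      · exact zero_le
      · rw [hc]
        apply G_le _ (by positivity)
        exact (mn_le b s.1 ⟨0, by omega⟩).trans (cnt_le _ _)
    exact add_le_add (this _) (this _)
  calc _ ≤ ∑ s, init n μ s * ENNReal.ofReal (2 * (16 * μ * n * (2 + Real.log n))) := by
        gcongr with s _
        exact hb s
    _ ≤ _ := by
        rw [← Finset.sum_mul]
        exact mul_le_of_le_one_left zero_le (init_sum n μ)

/-- adapted from Theorem 5 in Friedrich–Oliveto–Sudholt–Witt: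
for every population size μ = μ(n) ≥ 2, the (μ+1) EA with population-level fitness
sharing finds both optima of TwoMax in expected O(μ n log n) generations. -/
theorem muPlusOneEA_TwoMax_population_fitness_sharing
    (μ : ℕ → ℕ) (hμ : ∀ n, 2 ≤ μ n) :
    ∃ C : ℝ, 0 < C ∧ ∀ᶠ n : ℕ in atTop,
      expFindBoth n (μ n) ≤ ENNReal.ofReal (C * μ n * n * Real.log n) := by
  refine ⟨96, by norm_num, ?_⟩
  filter_upwards [eventually_ge_atTop 3] with n hn
  refine (main_bound (by omega) (hμ n)).trans (ENNReal.ofReal_le_ofReal ?_)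
  have hl : 1 ≤ Real.log n := by
    rw [Real.le_log_iff_exp_le (by positivity)]
    have : (3:ℝ) ≤ n := by exact_mod_cast hn
    linarith [Real.exp_one_lt_d9]
  have h0 : (0:ℝ) ≤ (μ n : ℝ) * n := by positivity
  nlinarith

end Stmt7
end
end

section
/- Let the niche capacity κ ≥ 1 be given, and let the population size satisfy κ n²/4 ≤ µ ≤ n^{O(1)}. Then the expected number of generations until the (µ+1) EA with clearing (either genotypic clearing using Hamming distance, or phenotypic clearing) with clearing radius σ = n/2 has found both optima of TwoMax is O(µ n log n). -/
open Filter
open scoped ENNReal BigOperators Classical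

noncomputable section

namespace Stmt9

/-- Inner loop of the clearing procedure: given the winner `i`, iterate through the
remaining individuals in fitness order; uncleared individuals within distance < σ of
the winner are counted towards its niche while fewer than κ winners have been counted,
and all further such individuals are cleared. -/
def clearInner {ι : Type*} [DecidableEq ι] (d : ι → ι → ℕ) (σ κ : ℕ) (i : ι) :
    List ι → Finset ι → ℕ → Finset ι
  | [], cleared, _ => cleared
  | j :: rest, cleared, cnt =>
    if j ∉ cleared ∧ d i j < σ then
      if cnt < κ then clearInner d σ κ i rest cleared (cnt + 1)
      else clearInner d σ κ i rest (insert j cleared) cnt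
    else clearInner d σ κ i rest cleared cnt

/-- Outer loop of the clearing procedure: process individuals in order of decreasing
fitness; every individual that has not been cleared becomes a winner of its niche. -/
def clearOuter {ι : Type*} [DecidableEq ι] (d : ι → ι → ℕ) (σ κ : ℕ) :
    List ι → Finset ι → Finset ι
  | [], cleared => cleared
  | i :: rest, cleared =>
    if i ∉ cleared then clearOuter d σ κ rest (clearInner d σ κ i rest cleared 1)
    else clearOuter d σ κ rest cleared

/-- the individuals of `Fin m`, sorted by decreasing fitness (ties broken by index) -/
def sortedByFitness (m : ℕ) (fit : Fin m → ℝ) : List (Fin m) :=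
  (List.finRange m).mergeSort fun a b => decide (fit b < fit a ∨ (fit a = fit b ∧ a ≤ b))

/-- the fitness after clearing: cleared individuals have their fitness set to 0 -/
def clearedFit {m : ℕ} (fit : Fin m → ℝ) (d : Fin m → Fin m → ℕ) (σ κ : ℕ) :
    Fin m → ℝ := fun i =>
  if i ∈ clearOuter d σ κ (sortedByFitness m fit) ∅ then 0 else fit i

/-- the phenotypic distance d(x,y) = ||x|₁ − |y|₁| -/
def pheDist {n : ℕ} (x y : BitString n) : ℕ :=
  ((onesCount x : ℤ) - (onesCount y : ℤ)).natAbs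

/-- State of a run: the current population together with two flags recording whether
the all-zeros string resp. the all-ones string has been created. -/
abbrev State (n μ : ℕ) := (Fin μ → BitString n) × Bool × Bool

/-- One generation of the (μ+1) EA with clearing (dissimilarity measure `d`, clearing
radius σ, niche capacity κ) on TwoMax: choose a parent uniformly at random, mutate it
to obtain `y`, compute the cleared fitness of all individuals in P ∪ {y}, choose z ∈ P
of worst cleared fitness uniformly at random and replace it by y if f'(y) ≥ f'(z). -/
def trans (n μ : ℕ) (d : ∀ {n : ℕ}, BitString n → BitString n → ℕ) (σ κ : ℕ) :
    State n μ → State n μ → ℝ≥0∞ := fun s s' =>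
  ∑ i : Fin μ, (μ : ℝ≥0∞)⁻¹ * ∑ y : BitString n, mutProb n (s.1 i) y *
    (let all : Fin (μ + 1) → BitString n := Fin.snoc s.1 y
     let cf : Fin (μ + 1) → ℝ :=
       clearedFit (fun a => (twoMax (all a) : ℝ)) (fun a b => d (all a) (all b)) σ κ
     let worst : Finset (Fin μ) :=
       Finset.univ.filter fun j => ∀ i' : Fin μ, cf j.castSucc ≤ cf i'.castSucc
     ∑ j ∈ worst, (worst.card : ℝ≥0∞)⁻¹ *
       (if s'.1 = (if cf (Fin.last μ) ≥ cf j.castSucc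
                   then Function.update s.1 j y else s.1) ∧
           s'.2.1 = (s.2.1 || decide (y = allZeros n)) ∧
           s'.2.2 = (s.2.2 || decide (y = allOnes n))
         then 1 else 0))

/-- Initialization: uniform over all populations of μ bit strings of length n. -/
def init (n μ : ℕ) : State n μ → ℝ≥0∞ := fun s =>
  ((2 : ℝ≥0∞) ^ (n * μ))⁻¹ *
    (if s.2.1 = decide (∃ i, s.1 i = allZeros n) ∧ s.2.2 = decide (∃ i, s.1 i = allOnes n)
      then 1 else 0)

/-- both optima have been created -/
def bothFound {n μ : ℕ} (s : State n μ) : Prop := s.2.1 = true ∧ s.2.2 = true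

/-- expected number of generations until both optima of TwoMax have been created -/
def expFindBoth (n μ : ℕ) (d : ∀ {n : ℕ}, BitString n → BitString n → ℕ) (σ κ : ℕ) :
    ℝ≥0∞ :=
  ∑' T : ℕ, probOf (evolve (init n μ) (trans n μ d σ κ) T) fun s => ¬ bothFound s

set_option linter.unusedSectionVars false

section Lists
variable {ι : Type*} [DecidableEq ι] (d : ι → ι → ℕ) (σ κ : ℕ)

lemma subset_clearInner (i : ι) : ∀ (l : List ι) (cl : Finset ι) (c : ℕ),
    cl ⊆ clearInner d σ κ i l cl c := by
  intro l
  induction l with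
  | nil => intro cl c; simp [clearInner]
  | cons j rest ih =>
    intro cl c
    simp only [clearInner]
    split_ifs
    · exact ih _ _
    · exact (Finset.subset_insert _ _).trans (ih _ _)
    · exact ih _ _

lemma clearInner_subset (i : ι) : ∀ (l : List ι) (cl : Finset ι) (c : ℕ) (x : ι),
    x ∈ clearInner d σ κ i l cl c → x ∈ cl ∨ (x ∈ l ∧ d i x < σ) := by
  intro l
  induction l with
  | nil => intro cl c x; simp [clearInner]
  | cons j rest ih =>
    intro cl c x
    simp only [clearInner]
    split_ifs with h1 h2
    · intro h; rcases ih _ _ _ h with h | h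
      · exact Or.inl h
      · exact Or.inr ⟨List.mem_cons_of_mem _ h.1, h.2⟩
    · intro h; rcases ih _ _ _ h with h | h
      · rcases Finset.mem_insert.1 h with h | h
        · subst h; exact Or.inr ⟨List.mem_cons_self, h1.2⟩
        · exact Or.inl h
      · exact Or.inr ⟨List.mem_cons_of_mem _ h.1, h.2⟩
    · intro h; rcases ih _ _ _ h with h | h
      · exact Or.inl h
      · exact Or.inr ⟨List.mem_cons_of_mem _ h.1, h.2⟩

lemma subset_clearOuter : ∀ (l : List ι) (cl : Finset ι),
    cl ⊆ clearOuter d σ κ l cl := by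
  intro l
  induction l with
  | nil => intro cl; simp [clearOuter]
  | cons j rest ih =>
    intro cl
    simp only [clearOuter]
    split_ifs
    swap
    · exact (subset_clearInner d σ κ j rest cl 1).trans (ih _)
    · exact ih _

lemma clearOuter_subset : ∀ (l : List ι) (cl : Finset ι) (x : ι),
    x ∈ clearOuter d σ κ l cl → x ∈ cl ∨ x ∈ l := by
  intro l
  induction l with
  | nil => intro cl x; simp [clearOuter]
  | cons j rest ih =>
    intro cl x
    simp only [clearOuter]
    split_ifs
    swap
    · intro h; rcases ih _ _ h with h | h
      · rcases clearInner_subset d σ κ _ _ _ _ _ h with h | h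
        · exact Or.inl h
        · exact Or.inr (List.mem_cons_of_mem _ h.1)
      · exact Or.inr (List.mem_cons_of_mem _ h)
    · intro h; rcases ih _ _ h with h | h
      · exact Or.inl h
      · exact Or.inr (List.mem_cons_of_mem _ h)

lemma head_not_cleared (i : ι) (rest : List ι) (hn : (i :: rest).Nodup) (cl : Finset ι)
    (hi : i ∉ cl) : i ∉ clearOuter d σ κ (i :: rest) cl := by
  simp only [clearOuter, hi, not_false_eq_true, if_true]
  have hr : i ∉ rest := (List.nodup_cons.1 hn).1
  intro h
  rcases clearOuter_subset d σ κ _ _ _ h with h | h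
  · rcases clearInner_subset d σ κ _ _ _ _ _ h with h | h
    · exact hi h
    · exact hr h.1
  · exact hr h

/-- each element has at most κ - 1 later close elements -/
def few (p : ι → ι → Prop) (κ : ℕ) : List ι → Prop
  | [] => True
  | i :: rest => rest.countP (fun j => decide (p i j)) + 1 ≤ κ ∧ few p κ rest

lemma inner_count (i : ι) : ∀ (l : List ι) (_ : l.Nodup) (cl : Finset ι) (c : ℕ),
    c ≤ κ → l.countP (fun j => decide (j ∉ clearInner d σ κ i l cl c ∧ d i j < σ)) + c ≤ κ := by
  intro l
  induction l with
  | nil => intro _ cl c hc; simpa using hc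
  | cons j rest ih =>
    intro hn cl c hc
    have hn' := List.nodup_cons.1 hn
    rw [List.countP_cons]
    simp only [clearInner]
    split_ifs with h1 h2 h3 h3 h3
    · have := ih hn'.2 cl (c+1) h2
      omega
    · have := ih hn'.2 cl (c+1) h2
      omega
    · exfalso
      rw [decide_eq_true_iff] at h3
      exact h3.1 (subset_clearInner d σ κ i rest _ _ (Finset.mem_insert_self _ _))
    · have := ih hn'.2 (insert j cl) c hc
      omega
    · exfalso
      rw [decide_eq_true_iff] at h3
      apply h1
      refine ⟨fun h => h3.1 (subset_clearInner d σ κ i rest _ _ h), h3.2⟩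
    · have := ih hn'.2 cl c hc
      omega

lemma few_clearOuter (hκ : 1 ≤ κ) : ∀ (l : List ι) (_ : l.Nodup) (cl : Finset ι),
    few (fun i j => d i j < σ) κ (l.filter (fun j => decide (j ∉ clearOuter d σ κ l cl))) := by
  intro l
  induction l with
  | nil => intro _ cl; simp [few]
  | cons i rest ih =>
    intro hn cl
    have hn' := List.nodup_cons.1 hn
    by_cases hi : i ∈ cl
    · have h2 : i ∈ clearOuter d σ κ (i :: rest) cl := subset_clearOuter d σ κ _ _ hi
      have h3 : clearOuter d σ κ (i :: rest) cl = clearOuter d σ κ rest cl := by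
        simp [clearOuter, hi]
      rw [List.filter_cons_of_neg (by simpa using h2), h3]
      exact ih hn'.2 cl
    · have h2 := head_not_cleared d σ κ i rest hn cl hi
      have h3 : clearOuter d σ κ (i :: rest) cl =
          clearOuter d σ κ rest (clearInner d σ κ i rest cl 1) := by
        simp [clearOuter, hi]
      rw [List.filter_cons_of_pos (by simpa using h2), h3]
      refine ⟨?_, ih hn'.2 _⟩
      refine le_trans ?_ (inner_count d σ κ i rest hn'.2 cl 1 hκ)
      rw [List.countP_filter]
      gcongr
      apply List.countP_mono_left
      intro x _ hx
      simp only [Bool.and_eq_true, decide_eq_true_iff] at hx ⊢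
      exact ⟨fun h => hx.2 (subset_clearOuter d σ κ _ _ h), hx.1⟩

lemma few_filter (p : ι → ι → Prop) (q : ι → Bool) : ∀ (l : List ι), few p κ l →
    few p κ (l.filter q) := by
  intro l
  induction l with
  | nil => intro _; simp [few]
  | cons i rest ih =>
    intro h
    by_cases hq : q i
    · rw [List.filter_cons_of_pos hq]
      refine ⟨?_, ih h.2⟩
      refine le_trans ?_ h.1
      gcongr
      exact List.Sublist.countP_le List.filter_sublist
    · rw [List.filter_cons_of_neg hq]
      exact ih h.2

lemma few_mono (p p' : ι → ι → Prop) (hp : ∀ i j, p' i j → p i j) : ∀ (l : List ι), few p κ l →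
    few p' κ l := by
  intro l
  induction l with
  | nil => intro _; simp [few]
  | cons i rest ih =>
    intro h
    refine ⟨le_trans ?_ h.1, ih h.2⟩
    gcongr
    apply List.countP_mono_left
    intro x _ hx
    simp only [decide_eq_true_iff] at hx ⊢
    exact hp _ _ hx

lemma inner_keep (i u : ι) (post : List ι) (hup : u ∉ post) : ∀ (pre : List ι) (_ : u ∉ pre)
    (cl : Finset ι) (c : ℕ), u ∉ cl →
    c + pre.countP (fun j => decide (j ∉ cl)) < κ →
    u ∉ clearInner d σ κ i (pre ++ u :: post) cl c := by
  intro pre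
  induction pre with
  | nil =>
    intro _ cl c hu hc
    simp only [List.countP_nil, add_zero] at hc
    simp only [List.nil_append, clearInner]
    intro h
    split_ifs at h
    all_goals
      rcases clearInner_subset d σ κ _ _ _ _ _ h with h | h
      · exact hu h
      · exact hup h.1
  | cons j pre ih =>
    intro hpre cl c hu hc
    have hj : u ≠ j := fun h => hpre (h ▸ List.mem_cons_self)
    have hpre' : u ∉ pre := fun h => hpre (List.mem_cons_of_mem _ h)
    rw [List.countP_cons] at hc
    simp only [List.cons_append, clearInner]
    split_ifs with h1 h2
    · apply ih hpre' _ _ hu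
      simp only [h1.1, not_false_eq_true, decide_true, if_true] at hc
      omega
    · omega
    · apply ih hpre' _ _ hu
      omega

lemma outer_keep (u : ι) (post : List ι) : ∀ (pre : List ι) (_ : (pre ++ u :: post).Nodup)
    (cl : Finset ι), u ∉ cl →
    pre.countP (fun j => decide (j ∉ cl)) < κ →
    u ∉ clearOuter d σ κ (pre ++ u :: post) cl := by
  intro pre
  induction pre with
  | nil => intro hn cl hu hc; exact head_not_cleared d σ κ u post hn cl hu
  | cons i pre ih =>
    intro hn cl hu hc
    have hn' := List.nodup_cons.1 hn
    rw [List.countP_cons] at hc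
    simp only [List.cons_append, clearOuter]
    split_ifs with h1
    swap
    · simp only [h1, not_false_eq_true, decide_true, if_true] at hc
      have hnd := List.nodup_append.1 hn'.2
      apply ih hn'.2
      · apply inner_keep d σ κ i u post (List.nodup_cons.1 hnd.2.1).1 pre
          (fun h => hnd.2.2 u h u List.mem_cons_self rfl) cl 1 hu
        omega
      · refine lt_of_le_of_lt ?_ (lt_of_le_of_lt (Nat.le_succ _) hc)
        apply List.countP_mono_left
        intro x _ hx
        simp only [decide_eq_true_iff] at hx ⊢
        exact fun h => hx (subset_clearInner d σ κ _ _ _ _ h)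
    · exact ih hn'.2 cl hu (by omega)

lemma first_keep (hκ : 1 ≤ κ) (w u : ι) (pre post : List ι) (hn : (w :: (pre ++ u :: post)).Nodup)
    (hu : σ ≤ d w u) (hpre : ∀ x ∈ pre, d w x < σ) :
    u ∉ clearOuter d σ κ (w :: (pre ++ u :: post)) ∅ := by
  have hn' := List.nodup_cons.1 hn
  simp only [clearOuter, Finset.notMem_empty, not_false_eq_true, if_true]
  apply outer_keep d σ κ u post pre hn'.2
  · intro h
    rcases clearInner_subset d σ κ _ _ _ _ _ h with h | h
    · simp at h
    · omega
  · have := inner_count d σ κ w _ hn'.2 ∅ 1 hκ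
    rw [List.countP_append] at this
    have h2 : pre.countP (fun j => decide (j ∉ clearInner d σ κ w (pre ++ u :: post) ∅ 1)) ≤
      pre.countP (fun j => decide (j ∉ clearInner d σ κ w (pre ++ u :: post) ∅ 1 ∧ d w j < σ)) := by
      apply List.countP_mono_left
      intro x hx hx2
      simp only [decide_eq_true_iff] at hx2 ⊢
      exact ⟨hx2, hpre x hx⟩
    omega

end Lists

section Code
variable {n : ℕ}

def sgn (b : Bool) : ℤ := if b then 1 else -1

lemma sgn_sq (b : Bool) : sgn b * sgn b = 1 := by cases b <;> simp [sgn]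

lemma ip_eq (x y : BitString n) :
    ∑ k, sgn (x k) * sgn (y k) = (n : ℤ) - 2 * hammingDist x y := by
  have h : ∀ k, sgn (x k) * sgn (y k) = 1 - 2 * (if x k ≠ y k then 1 else 0) := by
    intro k
    cases x k <;> cases y k <;> simp [sgn]
  have h2 : ((hammingDist x y : ℕ) : ℤ) = ∑ k, (if x k ≠ y k then 1 else 0) := by
    simp only [hammingDist, Finset.card_filter]
    push_cast
    rfl
  simp only [h, Finset.sum_sub_distrib, ← Finset.mul_sum, h2]
  simp

variable {ι : Type*} (f : ι → BitString n) (κ : ℕ)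

def Sv (l : List ι) (k : Fin n) : ℤ := (l.map fun i => sgn (f i k)).sum

lemma sum_sgn_Sv (x : BitString n) (l : List ι) :
    ∑ k, sgn (x k) * Sv f l k ≤ l.length +
      n * (l.countP fun j => decide (hammingDist x (f j) < n / 2)) := by
  induction l with
  | nil => simp [Sv]
  | cons j l ih =>
    have h1 : ∀ k, Sv f (j :: l) k = sgn (f j k) + Sv f l k := by intro k; simp [Sv]
    simp only [h1, mul_add, Finset.sum_add_distrib, ip_eq, List.countP_cons, List.length_cons]
    push_cast
    have h2 : (n : ℤ) - 2 * hammingDist x (f j) ≤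
        1 + n * (if decide (hammingDist x (f j) < n / 2) = true then 1 else 0) := by
      split_ifs with h
      · omega
      · simp only [decide_eq_true_iff] at h
        omega
    have h3 : ((if decide (hammingDist x (f j) < n / 2) = true then 1 else 0 : ℕ) : ℤ) =
      (if decide (hammingDist x (f j) < n / 2) = true then 1 else 0 : ℤ) := by
      split_ifs <;> simp
    nlinarith

lemma Sv_sq (l : List ι) (h : few (fun i j => hammingDist (f i) (f j) < n / 2) κ l) :
    ∑ k, (Sv f l k) ^ 2 ≤ (l.length : ℤ) * n * (2 * κ - 1) + l.length * (l.length - 1) := by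
  induction l with
  | nil => simp [Sv]
  | cons j l ih =>
    have h1 : ∀ k, Sv f (j :: l) k ^ 2 = sgn (f j k) * sgn (f j k) +
        2 * (sgn (f j k) * Sv f l k) + Sv f l k ^ 2 := by intro k; simp [Sv]; ring
    simp only [h1, Finset.sum_add_distrib, ← Finset.mul_sum, sgn_sq]
    have h2 := sum_sgn_Sv f (f j) l
    have h3 := ih h.2
    simp only [Finset.sum_const, Finset.card_univ, Fintype.card_fin, List.length_cons]
    set c := l.countP fun i => decide (hammingDist (f j) (f i) < n / 2) with hc
    have h4 : c + 1 ≤ κ := by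
      rw [hc]
      convert h.1
    have h5 : (n : ℤ) * c ≤ n * (κ - 1) := by
      apply mul_le_mul_of_nonneg_left _ (by positivity)
      have : ((c + 1 : ℕ) : ℤ) ≤ κ := by exact_mod_cast h4
      push_cast at this
      linarith
    push_cast
    simp only [nsmul_eq_mul, mul_one]
    nlinarith

lemma class_bound (l : List ι) (h : few (fun i j => hammingDist (f i) (f j) < n / 2) κ l)
    (k0 k1 : Fin n) (hk : k0 ≠ k1) (a b : Bool) (ha : ∀ i ∈ l, f i k0 = a)
    (hb : ∀ i ∈ l, f i k1 = b) : l.length ≤ 2 * κ * n := by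
  have h1 := Sv_sq f κ l h
  have e : ∀ (k : Fin n) (a : Bool), (∀ i ∈ l, f i k = a) → Sv f l k ^ 2 = (l.length : ℤ) ^ 2 := by
    intro k a ha
    have : l.map (fun i => sgn (f i k)) = l.map (fun _ => sgn a) :=
      List.map_congr_left (fun i hi => by rw [ha i hi])
    unfold Sv
    rw [this]
    simp only [List.map_const', List.sum_replicate, nsmul_eq_mul]
    have := sgn_sq a
    linear_combination (l.length : ℤ)^2 * this
  have h2 : Sv f l k0 ^ 2 + Sv f l k1 ^ 2 ≤ ∑ k, (Sv f l k) ^ 2 := by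
    rw [← Finset.sum_pair (f := fun k => Sv f l k ^ 2) hk]
    exact Finset.sum_le_sum_of_subset_of_nonneg (Finset.subset_univ _)
      (fun _ _ _ => by positivity)
  rw [e k0 a ha, e k1 b hb] at h2
  rcases Nat.eq_zero_or_pos l.length with h0 | h0
  · omega
  have h0' : (0 : ℤ) < l.length := by exact_mod_cast h0
  have h3 : (l.length : ℤ) * l.length ≤ l.length * (2 * κ * n) := by nlinarith
  have h4 := le_of_mul_le_mul_left h3 h0'
  exact_mod_cast h4

lemma code_bound (hn : 2 ≤ n) (l : List ι)
    (h : few (fun i j => hammingDist (f i) (f j) < n / 2) κ l) : l.length ≤ 8 * κ * n := by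
  let k0 : Fin n := ⟨0, by omega⟩
  let k1 : Fin n := ⟨1, by omega⟩
  have hk : k0 ≠ k1 := by simp [k0, k1]
  have key : ∀ (q0 q1 : ι → Bool) (a b : Bool), (∀ i, q0 i = true → f i k0 = a) →
      (∀ i, q1 i = true → f i k1 = b) → ((l.filter q0).filter q1).length ≤ 2 * κ * n := by
    intro q0 q1 a b h0 h1
    apply class_bound f κ _ (few_filter κ _ _ _ (few_filter κ _ _ _ h)) k0 k1 hk a b
    · intro i hi
      simp only [List.mem_filter] at hi
      exact h0 i hi.1.2
    · intro i hi
      simp only [List.mem_filter] at hi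
      exact h1 i hi.2
  have e0 := List.length_eq_length_filter_add (l := l) (fun i => f i k0)
  have e1 := List.length_eq_length_filter_add (l := l.filter (fun i => f i k0)) (fun i => f i k1)
  have e2 := List.length_eq_length_filter_add (l := l.filter (fun i => !f i k0)) (fun i => f i k1)
  have b1 := key (fun i => f i k0) (fun i => f i k1) true true (by simp) (by simp)
  have b2 := key (fun i => f i k0) (fun i => !f i k1) true false (by simp) (by simp)
  have b3 := key (fun i => !f i k0) (fun i => f i k1) false true (by simp) (by simp)
  have b4 := key (fun i => !f i k0) (fun i => !f i k1) false false (by simp) (by simp)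
  have : 8 * κ * n = 4 * (2 * κ * n) := by ring
  omega

end Code

section Sorting

lemma sorted_perm (m : ℕ) (fit : Fin m → ℝ) :
    (sortedByFitness m fit).Perm (List.finRange m) := List.mergeSort_perm _ _

lemma sorted_nodup (m : ℕ) (fit : Fin m → ℝ) : (sortedByFitness m fit).Nodup :=
  (sorted_perm m fit).nodup_iff.2 (List.nodup_finRange m)

lemma mem_sorted (m : ℕ) (fit : Fin m → ℝ) (i : Fin m) : i ∈ sortedByFitness m fit :=
  (sorted_perm m fit).mem_iff.2 (List.mem_finRange i)

lemma sorted_pairwise (m : ℕ) (fit : Fin m → ℝ) :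
    (sortedByFitness m fit).Pairwise (fun a b => fit b ≤ fit a) := by
  have h := List.pairwise_mergeSort (le := fun a b : Fin m =>
      decide (fit b < fit a ∨ (fit a = fit b ∧ a ≤ b))) ?_ ?_ (List.finRange m)
  · refine List.Pairwise.imp ?_ h
    intro a b hab
    simp only [decide_eq_true_iff] at hab
    rcases hab with h | h
    · exact h.le
    · exact h.1.ge
  · intro a b c hab hbc
    simp only [decide_eq_true_iff] at *
    rcases hab with h | h <;> rcases hbc with h' | h'
    · exact Or.inl (h'.trans h)
    · exact Or.inl (h'.1 ▸ h)
    · exact Or.inl (h.1 ▸ h')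
    · exact Or.inr ⟨h.1.trans h'.1, h.2.trans h'.2⟩
  · intro a b
    simp only [Bool.or_eq_true, decide_eq_true_iff]
    rcases lt_trichotomy (fit a) (fit b) with h | h | h
    · exact Or.inr (Or.inl h)
    · rcases le_total a b with h' | h'
      · exact Or.inl (Or.inr ⟨h, h'⟩)
      · exact Or.inr (Or.inr ⟨h.symm, h'⟩)
    · exact Or.inl (Or.inl h)

end Sorting

section Opt
variable {n : ℕ}

def opt (n : ℕ) (b : Bool) : BitString n := fun _ => b

/-- distance from an optimum -/
def hd (b : Bool) (x : BitString n) : ℕ := hammingDist (opt n b) x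

lemma hd_false (x : BitString n) : hd false x = onesCount x := by
  unfold hd hammingDist onesCount opt
  congr 1
  ext i
  simp

lemma hd_add (x : BitString n) : hd true x + hd false x = n := by
  unfold hd hammingDist opt
  have := Finset.card_filter_add_card_filter_not (s := (Finset.univ : Finset (Fin n)))
    (fun i => x i = false)
  simp only [Finset.card_univ, Fintype.card_fin] at this
  refine Eq.trans ?_ this
  congr 2
  · ext i
    cases h : x i <;> simp [h]
  · ext i
    cases h : x i <;> simp [h]

lemma hd_le (b : Bool) (x : BitString n) : hd b x ≤ n := by
  have := hd_add x
  cases b <;> omega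

lemma hd_not (b : Bool) (x : BitString n) : hd (!b) x = n - hd b x := by
  have := hd_add x
  cases b <;> simp only [Bool.not_true, Bool.not_false] <;> omega

lemma twoMax_hd (b : Bool) (x : BitString n) : twoMax x = max (hd b x) (n - hd b x) := by
  have := hd_add x
  unfold twoMax
  rw [← hd_false]
  cases b
  · rfl
  · omega

lemma hd_eq_zero {b : Bool} {x : BitString n} : hd b x = 0 ↔ x = opt n b := by
  unfold hd
  rw [hammingDist_eq_zero, eq_comm]

lemma hd_eq_n {b : Bool} {x : BitString n} : hd b x = n ↔ x = opt n (!b) := by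
  rw [← hd_eq_zero, hd_not]
  have := hd_le b x
  omega

lemma hd_opt_not (b : Bool) : hd b (opt n (!b)) = n := hd_eq_n.2 rfl

lemma hd_opt (b : Bool) : hd b (opt n b) = 0 := hd_eq_zero.2 rfl

lemma twoMax_le (x : BitString n) : twoMax x ≤ n := by
  have := hd_le false x
  rw [twoMax_hd false]; omega

lemma twoMax_pos (hn : 0 < n) (x : BitString n) : 0 < twoMax x := by
  have := hd_le false x
  rw [twoMax_hd false]; omega

lemma twoMax_eq_n (hn : 0 < n) (b : Bool) {x : BitString n} :
    twoMax x = n ↔ x = opt n b ∨ x = opt n (!b) := by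
  rw [← hd_eq_zero, ← hd_eq_n (b := b), twoMax_hd b]
  have := hd_le b x
  omega

lemma phe_opt (b : Bool) (x : BitString n) : pheDist (opt n b) x = hd b x := by
  have h1 := hd_add x
  have h2 := hd_add (opt n b)
  unfold pheDist
  rw [← hd_false, ← hd_false]
  cases b
  · rw [hd_opt false]; omega
  · rw [hd_opt true] at h2; omega

lemma phe_le (x y : BitString n) : pheDist x y ≤ hammingDist x y := by
  have h1 := hammingDist_triangle (opt n false) x y
  have h2 := hammingDist_triangle (opt n false) y x
  rw [hammingDist_comm y x] at h2
  unfold pheDist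
  rw [← hd_false, ← hd_false]
  unfold hd
  omega

end Opt

lemma first_split {α : Type*} (p : α → Prop) : ∀ (l : List α), (∃ a ∈ l, p a) →
    ∃ pre u post, l = pre ++ u :: post ∧ p u ∧ ∀ x ∈ pre, ¬ p x := by
  intro l
  induction l with
  | nil => rintro ⟨a, ha, _⟩; simp at ha
  | cons i l ih =>
    rintro ⟨a, ha, hp⟩
    by_cases hi : p i
    · exact ⟨[], i, l, rfl, hi, by simp⟩
    · have : a ∈ l := by
        rcases List.mem_cons.1 ha with h | h
        · exact absurd (h ▸ hp) hi
        · exact h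
      obtain ⟨pre, u, post, h1, h2, h3⟩ := ih ⟨a, this, hp⟩
      refine ⟨i :: pre, u, post, by rw [h1]; rfl, h2, ?_⟩
      intro x hx
      rcases List.mem_cons.1 hx with h | h
      · exact h ▸ hi
      · exact h3 x h

section Step
variable {n μ : ℕ} (d : BitString n → BitString n → ℕ) (κ : ℕ)

def allP (P : Fin μ → BitString n) (y : BitString n) : Fin (μ + 1) → BitString n := Fin.snoc P y

@[simp] lemma allP_castSucc (P : Fin μ → BitString n) (y : BitString n) (i : Fin μ) :
    allP P y i.castSucc = P i := by simp [allP]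

@[simp] lemma allP_last (P : Fin μ → BitString n) (y : BitString n) :
    allP P y (Fin.last μ) = y := by simp [allP]

def srt (P : Fin μ → BitString n) (y : BitString n) : List (Fin (μ + 1)) :=
  sortedByFitness (μ + 1) (fun a => (twoMax (allP P y a) : ℝ))

def clr (P : Fin μ → BitString n) (y : BitString n) : Finset (Fin (μ + 1)) :=
  clearOuter (fun a b => d (allP P y a) (allP P y b)) (n / 2) κ (srt P y) ∅

def worstS (P : Fin μ → BitString n) (y : BitString n) : Finset (Fin μ) :=
  Finset.univ.filter fun j => j.castSucc ∈ clr d κ P y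

lemma srt_nodup (P : Fin μ → BitString n) (y : BitString n) : (srt P y).Nodup :=
  sorted_nodup _ _

lemma srt_pair (P : Fin μ → BitString n) (y : BitString n) :
    (srt P y).Pairwise (fun a b => twoMax (allP P y b) ≤ twoMax (allP P y a)) := by
  have := sorted_pairwise (μ + 1) (fun a => (twoMax (allP P y a) : ℝ))
  exact this.imp (fun h => by exact_mod_cast h)

lemma srt_cons (P : Fin μ → BitString n) (y : BitString n) :
    ∃ w rest, srt P y = w :: rest ∧ w ∉ clr d κ P y ∧
      ∀ a, twoMax (allP P y a) ≤ twoMax (allP P y w) := by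
  have hmem : ∀ a, a ∈ srt P y := mem_sorted _ _
  have hnd := srt_nodup P y
  have hp := srt_pair P y
  unfold clr
  rcases h : srt P y with _ | ⟨w, rest⟩
  · have := hmem (Fin.last μ)
    rw [h] at this
    simp at this
  · rw [h] at hmem hnd hp
    refine ⟨w, rest, rfl, head_not_cleared _ _ _ _ _ hnd _ (by simp), ?_⟩
    intro a
    rcases List.mem_cons.1 (hmem a) with h | h
    · rw [h]
    · exact (List.pairwise_cons.1 hp).1 a h

lemma winners_few (hκ : 1 ≤ κ) (P : Fin μ → BitString n) (y : BitString n) :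
    few (fun i j => d (allP P y i) (allP P y j) < n / 2) κ
      ((srt P y).filter (fun j => decide (j ∉ clr d κ P y))) :=
  few_clearOuter _ _ κ hκ _ (srt_nodup P y) _

lemma winners_card (P : Fin μ → BitString n) (y : BitString n) :
    ((srt P y).filter (fun j => decide (j ∉ clr d κ P y))).length + (clr d κ P y).card = μ + 1 := by
  have h1 : ((srt P y).filter (fun j => decide (j ∉ clr d κ P y))).toFinset = (clr d κ P y)ᶜ := by
    ext a
    have : a ∈ srt P y := mem_sorted _ _ a
    simp [this]
  have h2 := List.toFinset_card_of_nodup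
    ((srt_nodup P y).filter (fun j => decide (j ∉ clr d κ P y)))
  rw [← h2, h1, Finset.card_compl]
  have := Finset.card_le_univ (clr d κ P y)
  simp only [Fintype.card_fin] at *
  omega

lemma card_worstS (P : Fin μ → BitString n) (y : BitString n) :
    (clr d κ P y).card ≤ (worstS d κ P y).card + 1 := by
  have : clr d κ P y ⊆ insert (Fin.last μ) ((worstS d κ P y).map Fin.castSuccEmb) := by
    intro a ha
    induction a using Fin.lastCases with
    | last => simp
    | cast i => 
      apply Finset.mem_insert_of_mem
      simp [worstS, ha]
  refine (Finset.card_le_card this).trans ((Finset.card_insert_le _ _).trans ?_)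
  rw [Finset.card_map]

lemma worstS_nonempty (hd2 : ∀ x y, d x y ≤ hammingDist x y) (hκ : 1 ≤ κ) (hn : 33 ≤ n)
    (hμ : κ * n ^ 2 ≤ 4 * μ) (P : Fin μ → BitString n) (y : BitString n) :
    (worstS d κ P y).Nonempty := by
  rw [← Finset.card_pos]
  have h1 := winners_card d κ P y
  have h2 := card_worstS d κ P y
  have h3 := code_bound (allP P y) κ (by omega) _
    (few_mono κ _ (fun i j => hammingDist (allP P y i) (allP P y j) < n / 2)
      (fun i j h => lt_of_le_of_lt (hd2 _ _) h) _ (winners_few d κ hκ P y))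
  have h4 : 8 * κ * n < μ := by
    have : κ * n * 33 ≤ κ * n * n := Nat.mul_le_mul_left _ hn
    have h6 : 0 < κ * n := Nat.mul_pos hκ (by omega)
    nlinarith
  omega

lemma contains_of_not_cleared {P : Fin μ → BitString n} {y : BitString n} {j : Fin μ}
    (hj : j ∈ worstS d κ P y) {w : Fin (μ + 1)} (hw : w ∉ clr d κ P y) :
    ∃ i, Function.update P j y i = allP P y w := by
  induction w using Fin.lastCases with
  | last => exact ⟨j, by simp⟩
  | cast i =>
    refine ⟨i, ?_⟩
    have : i ≠ j := by
      rintro rfl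
      simp only [worstS, Finset.mem_filter] at hj
      exact hw hj.2
    simp [Function.update_of_ne this]

lemma srt_head_opt (hn : 0 < n) (b : Bool) {P : Fin μ → BitString n} {y : BitString n}
    (h1 : ∃ a, allP P y a = opt n b) (h2 : ∀ a, allP P y a ≠ opt n (!b)) :
    ∃ w rest, srt P y = w :: rest ∧ w ∉ clr d κ P y ∧ allP P y w = opt n b := by
  obtain ⟨w, rest, hs, hw, hmax⟩ := srt_cons d κ P y
  refine ⟨w, rest, hs, hw, ?_⟩
  obtain ⟨a, ha⟩ := h1
  have h3 : twoMax (allP P y a) = n := (twoMax_eq_n hn b).2 (Or.inl ha)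
  have h4 : twoMax (allP P y w) = n := le_antisymm (twoMax_le _) (h3.ge.trans (hmax a))
  rcases (twoMax_eq_n hn b).1 h4 with h | h
  · exact h
  · exact absurd h (h2 w)

lemma d_opt (hd1 : ∀ x y, pheDist x y ≤ d x y) (hd2 : ∀ x y, d x y ≤ hammingDist x y)
    (b : Bool) (x : BitString n) : d (opt n b) x = hd b x :=
  le_antisymm (hd2 _ _) (phe_opt b x ▸ hd1 _ _)

lemma far_kept (hd1 : ∀ x y, pheDist x y ≤ d x y) (hd2 : ∀ x y, d x y ≤ hammingDist x y)
    (hκ : 1 ≤ κ) (hn : 33 ≤ n) (b : Bool) {P : Fin μ → BitString n} {y : BitString n}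
    (h1 : ∃ a, allP P y a = opt n b) (h2 : ∀ a, allP P y a ≠ opt n (!b))
    (a : Fin (μ + 1)) (ha : n / 2 ≤ hd b (allP P y a)) :
    ∃ u, u ∉ clr d κ P y ∧ n / 2 ≤ hd b (allP P y u) ∧
      twoMax (allP P y a) ≤ twoMax (allP P y u) := by
  obtain ⟨w, rest, hs, hw, hwo⟩ := srt_head_opt d κ (by omega) b h1 h2
  have hmem : ∀ a, a ∈ srt P y := mem_sorted _ _
  have haw : a ≠ w := by
    rintro rfl
    rw [hwo, hd_opt] at ha
    omega
  have har : a ∈ rest := by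
    have := hmem a
    rw [hs] at this
    exact (List.mem_cons.1 this).resolve_left haw
  obtain ⟨pre, u, post, h3, h4, h5⟩ :=
    first_split (fun a => n / 2 ≤ hd b (allP P y a)) rest ⟨a, har, ha⟩
  refine ⟨u, ?_, h4, ?_⟩
  · unfold clr
    have hnd := srt_nodup P y
    rw [hs, h3] at hnd ⊢
    apply first_keep _ _ _ hκ _ _ _ _ hnd
    · simp only [hwo, d_opt d hd1 hd2]; exact h4
    · intro x hx
      simp only [hwo, d_opt d hd1 hd2]
      exact not_le.1 (h5 x hx)
  · have hp := srt_pair P y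
    rw [hs, h3] at hp
    have hp2 := (List.pairwise_append.1 (List.pairwise_cons.1 hp).2).2.1
    rw [h3] at har
    rcases List.mem_append.1 har with h | h
    · exact absurd ha (h5 a h)
    · rcases List.mem_cons.1 h with h | h
      · rw [h]
      · exact (List.pairwise_cons.1 hp2).1 a h

lemma near_card (hd1 : ∀ x y, pheDist x y ≤ d x y) (hd2 : ∀ x y, d x y ≤ hammingDist x y)
    (hκ : 1 ≤ κ) (hn : 33 ≤ n) (b : Bool) {P : Fin μ → BitString n} {y : BitString n}
    (h1 : ∃ a, allP P y a = opt n b) (h2 : ∀ a, hd b (allP P y a) < n / 2) :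
    μ ≤ (worstS d κ P y).card + κ := by
  have h2' : ∀ a, allP P y a ≠ opt n (!b) := by
    intro a ha
    have := h2 a
    rw [ha, hd_opt_not] at this
    omega
  obtain ⟨w, rest, hs, hw, hwo⟩ := srt_head_opt d κ (by omega) b h1 h2'
  have h3 := winners_card d κ P y
  have h4 := card_worstS d κ P y
  have h5 := winners_few d κ hκ P y
  rw [hs, List.filter_cons_of_pos (by simpa using hw)] at h3 h5
  have h6 := h5.1
  rw [List.countP_eq_length.2] at h6
  · simp only [List.length_cons] at h3
    omega
  · intro a _
    refine @decide_eq_true _ (_) ?_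
    show d (allP P y w) (allP P y a) < n / 2
    rw [hwo, d_opt d hd1 hd2]
    exact h2 a

end Step

section Mut
variable {n : ℕ}

def mr (x y : BitString n) : ℝ :=
  ((n : ℝ)⁻¹) ^ hammingDist x y * (1 - (n : ℝ)⁻¹) ^ (n - hammingDist x y)

lemma inv_le_one' (hn : 1 ≤ n) : (n : ℝ)⁻¹ ≤ 1 := by
  apply inv_le_one_of_one_le₀
  exact_mod_cast hn

lemma mr_nonneg (hn : 1 ≤ n) (x y : BitString n) : 0 ≤ mr x y := by
  have := inv_le_one' hn
  unfold mr
  have h : 0 ≤ 1 - (n : ℝ)⁻¹ := by linarith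
  positivity

lemma mutProb_eq (hn : 1 ≤ n) (x y : BitString n) : mutProb n x y = ENNReal.ofReal (mr x y) := by
  have h1 := inv_le_one' hn
  have h : 0 ≤ 1 - (n : ℝ)⁻¹ := by linarith
  have hn' : (0 : ℝ) < n := by exact_mod_cast hn
  unfold mr mutProb
  rw [ENNReal.ofReal_mul (by positivity), ENNReal.ofReal_pow (by positivity),
    ENNReal.ofReal_pow h, ENNReal.ofReal_sub _ (by positivity), ENNReal.ofReal_inv_of_pos hn']
  simp

def q1 (p : ℝ) (a c : Bool) : ℝ := if a ≠ c then p else 1 - p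

lemma mr_prod (x y : BitString n) : mr x y = ∏ k, q1 ((n : ℝ)⁻¹) (x k) (y k) := by
  unfold q1 mr
  rw [Finset.prod_ite, Finset.prod_const, Finset.prod_const]
  congr 2
  have := Finset.card_filter_add_card_filter_not (s := (Finset.univ : Finset (Fin n)))
    (fun i => x i ≠ y i)
  simp only [Finset.card_univ, Fintype.card_fin] at this
  unfold hammingDist
  omega

lemma sum_prod_bool (q : Fin n → Bool → ℝ) :
    ∑ y : BitString n, ∏ k, q k (y k) = ∏ k, (q k true + q k false) := by
  have := Finset.prod_univ_sum (fun _ : Fin n => (Finset.univ : Finset Bool)) q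
  rw [Fintype.piFinset_univ] at this
  rw [← this]
  simp

lemma mr_sum (x : BitString n) : ∑ y, mr x y = 1 := by
  simp only [mr_prod]
  rw [sum_prod_bool (fun k c => q1 _ (x k) c)]
  apply Finset.prod_eq_one
  intro k _
  cases x k <;> simp [q1]

lemma hd_sum (b : Bool) (y : BitString n) : (hd b y : ℝ) = ∑ l, if b ≠ y l then (1 : ℝ) else 0 := by
  unfold hd hammingDist opt
  rw [Finset.card_filter]
  push_cast
  rfl

lemma mr_hd (hn : 1 ≤ n) (b : Bool) (x : BitString n) :
    ∑ y, mr x y * hd b y = hd b x * (1 - 2 / n) + 1 := by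
  have hn' : (n : ℝ) ≠ 0 := by positivity
  simp only [hd_sum, Finset.mul_sum]
  rw [Finset.sum_comm]
  have key : ∀ l, ∑ y : BitString n, mr x y * (if b ≠ y l then (1 : ℝ) else 0) =
      (if b ≠ x l then (1 : ℝ) else 0) * (1 - 2 / n) + (n : ℝ)⁻¹ := by
    intro l
    have h1 : ∀ y : BitString n, mr x y * (if b ≠ y l then (1 : ℝ) else 0) =
        ∏ k, (fun k c => q1 ((n : ℝ)⁻¹) (x k) c *
          (if k = l then (if b ≠ c then (1 : ℝ) else 0) else 1)) k (y k) := by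
      intro y
      simp only [Finset.prod_mul_distrib, ← mr_prod, Finset.prod_ite_eq', Finset.mem_univ, if_true]
    rw [Finset.sum_congr rfl (fun y _ => h1 y), sum_prod_bool (fun k c => q1 ((n : ℝ)⁻¹) (x k) c *
          (if k = l then (if b ≠ c then (1 : ℝ) else 0) else 1)), Finset.prod_eq_single l]
    · simp only [if_true]
      cases b <;> cases x l <;> simp [q1] <;> ring
    · intro k _ hk
      simp only [hk, if_false]
      cases x k <;> simp [q1]
    · simp
  simp only [key, Finset.sum_add_distrib, ← Finset.sum_mul]
  simp [hn']

def flipT (x : BitString n) (T : Finset (Fin n)) : BitString n :=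
  fun k => if k ∈ T then !(x k) else x k

lemma flipT_inj (x : BitString n) : Function.Injective (flipT x) := by
  intro T T' h
  ext k
  have := congrFun h k
  unfold flipT at this
  by_cases h1 : k ∈ T <;> by_cases h2 : k ∈ T' <;> simp [h1, h2] at this ⊢

lemma ham_flipT (x : BitString n) (T : Finset (Fin n)) : hammingDist x (flipT x T) = T.card := by
  unfold hammingDist flipT
  congr 1
  ext k
  by_cases h1 : k ∈ T <;> simp [h1]

lemma hd_flipT (b : Bool) (x : BitString n) (T : Finset (Fin n)) (hT : ∀ k ∈ T, x k = b) :
    hd b (flipT x T) = hd b x + T.card := by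
  unfold hd hammingDist flipT opt
  rw [← Finset.card_union_of_disjoint]
  · congr 1
    ext k
    by_cases h1 : k ∈ T
    · simp [h1, hT k h1]
    · simp [h1]
  · rw [Finset.disjoint_left]
    intro k hk hkT
    simp only [Finset.mem_filter] at hk
    exact hk.2 (hT k hkT).symm

lemma mr_flip (hn : 1 ≤ n) (b : Bool) (x : BitString n) (r : ℕ) :
    ((n - hd b x).choose r : ℝ) * (((n : ℝ)⁻¹) ^ r * (1 - (n : ℝ)⁻¹) ^ (n - r)) ≤
    ∑ y, if hd b y = hd b x + r then mr x y else 0 := by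
  let Z : Finset (Fin n) := Finset.univ.filter fun k => x k = b
  have hZ : Z.card = n - hd b x := by
    rw [← hd_not]
    unfold hd hammingDist opt
    congr 1
    ext k
    simp only [Z, Finset.mem_filter, Finset.mem_univ, true_and]
    cases b <;> cases x k <;> simp
  have h1 : ∑ y ∈ (Finset.powersetCard r Z).image (flipT x),
      (if hd b y = hd b x + r then mr x y else 0) =
      ((n - hd b x).choose r : ℝ) * (((n : ℝ)⁻¹) ^ r * (1 - (n : ℝ)⁻¹) ^ (n - r)) := by
    rw [Finset.sum_image (fun _ _ _ _ h => flipT_inj x h)]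
    rw [Finset.sum_congr rfl (g := fun _ => ((n : ℝ)⁻¹) ^ r * (1 - (n : ℝ)⁻¹) ^ (n - r))]
    · rw [Finset.sum_const, Finset.card_powersetCard, hZ, nsmul_eq_mul]
    · intro T hT
      rw [Finset.mem_powersetCard] at hT
      rw [hd_flipT b x T (fun k hk => (Finset.mem_filter.1 (hT.1 hk)).2), hT.2, if_pos rfl]
      unfold mr
      rw [ham_flipT, hT.2]
  rw [← h1]
  apply Finset.sum_le_sum_of_subset_of_nonneg (Finset.subset_univ _)
  intro y _ _
  split_ifs
  · exact mr_nonneg hn x y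
  · exact le_rfl

/-- lower bound for `(1-1/n)^(n-1)` -/
lemma pow_lower (hn : 2 ≤ n) (m : ℕ) (hm : m ≤ n - 1) : (1 : ℝ) / 3 ≤ (1 - (n : ℝ)⁻¹) ^ m := by
  have hn' : (2 : ℝ) ≤ n := by exact_mod_cast hn
  have h0 : (0 : ℝ) < 1 - (n : ℝ)⁻¹ := by
    have : (n : ℝ)⁻¹ ≤ 2⁻¹ := by gcongr
    linarith [show (2 : ℝ)⁻¹ < 1 by norm_num]
  have h1 : (1 - (n : ℝ)⁻¹) ^ (n - 1) ≤ (1 - (n : ℝ)⁻¹) ^ m := by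
    apply pow_le_pow_of_le_one h0.le _ hm
    have : (0 : ℝ) ≤ (n : ℝ)⁻¹ := by positivity
    linarith
  refine le_trans ?_ h1
  -- inverse is (1 + 1/(n-1))^(n-1) ≤ e
  have h2 : (1 - (n : ℝ)⁻¹)⁻¹ ≤ Real.exp (1 / (n - 1)) := by
    have := Real.add_one_le_exp (1 / ((n : ℝ) - 1))
    refine le_trans (le_of_eq ?_) this
    have : (n : ℝ) - 1 ≠ 0 := by linarith
    have : (n : ℝ) ≠ 0 := by linarith
    field_simp
    ring
  have h3 : ((1 - (n : ℝ)⁻¹)⁻¹) ^ (n - 1) ≤ Real.exp 1 := by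
    refine (pow_le_pow_left₀ (by positivity) h2 _).trans (le_of_eq ?_)
    rw [← Real.exp_nat_mul]
    congr 1
    rw [Nat.cast_sub (by omega)]
    have : (n : ℝ) - 1 ≠ 0 := by linarith
    push_cast
    field_simp
  have h4 : Real.exp 1 ≤ 3 := by linarith [Real.exp_one_lt_d9]
  rw [inv_pow] at h3
  rw [one_div]
  exact inv_le_of_inv_le₀ (by positivity) (h3.trans h4)

end Mut

section Trans
variable {n μ : ℕ} (d : ∀ {n : ℕ}, BitString n → BitString n → ℕ) (κ : ℕ)

def nextS (s : State n μ) (y : BitString n) (j : Fin μ) : State n μ :=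
  (Function.update s.1 j y, (s.2.1 || decide (y = allZeros n)), (s.2.2 || decide (y = allOnes n)))

def innerF (s : State n μ) (y : BitString n) (cf : Fin (μ + 1) → ℝ) (s' : State n μ) : ℝ≥0∞ :=
  ∑ j ∈ (Finset.univ.filter fun j : Fin μ => ∀ i' : Fin μ, cf j.castSucc ≤ cf i'.castSucc),
    ((Finset.univ.filter fun j : Fin μ => ∀ i' : Fin μ,
      cf j.castSucc ≤ cf i'.castSucc).card : ℝ≥0∞)⁻¹ *
       (if s'.1 = (if cf (Fin.last μ) ≥ cf j.castSucc
                   then Function.update s.1 j y else s.1) ∧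
           s'.2.1 = (s.2.1 || decide (y = allZeros n)) ∧
           s'.2.2 = (s.2.2 || decide (y = allOnes n))
         then 1 else 0)

lemma innerF_sum (s : State n μ) (y : BitString n) (cf : Fin (μ + 1) → ℝ) (W : Finset (Fin μ))
    (hw : (Finset.univ.filter fun j : Fin μ => ∀ i' : Fin μ, cf j.castSucc ≤ cf i'.castSucc) = W)
    (hacc : ∀ j ∈ W, cf (Fin.last μ) ≥ cf j.castSucc) (V : State n μ → ℝ≥0∞) :
    ∑ s', innerF s y cf s' * V s' = ∑ j ∈ W, (W.card : ℝ≥0∞)⁻¹ * V (nextS s y j) := by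
  unfold innerF
  simp only [hw, Finset.sum_mul]
  rw [Finset.sum_comm]
  refine Finset.sum_congr rfl fun j hj => ?_
  rw [Finset.sum_eq_single (nextS s y j)]
  · rw [if_pos, mul_one]
    rw [if_pos (hacc j hj)]
    exact ⟨rfl, rfl, rfl⟩
  · intro s' _ hs'
    rw [if_neg]
    · simp
    · rw [if_pos (hacc j hj)]
      rintro ⟨h1, h2, h3⟩
      exact hs' (Prod.ext h1 (Prod.ext h2 h3))
  · simp

def cfS (s : State n μ) (y : BitString n) : Fin (μ + 1) → ℝ :=
  clearedFit (fun a => (twoMax (allP s.1 y a) : ℝ))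
    (fun a b => d (allP s.1 y a) (allP s.1 y b)) (n / 2) κ

lemma trans_sum (hd2 : ∀ x y : BitString n, d x y ≤ hammingDist x y) (hκ : 1 ≤ κ) (hn : 33 ≤ n)
    (hμ : κ * n ^ 2 ≤ 4 * μ) (s : State n μ) (V : State n μ → ℝ≥0∞) :
    ∑ s', trans n μ d (n / 2) κ s s' * V s' =
    ∑ i : Fin μ, (μ : ℝ≥0∞)⁻¹ * ∑ y : BitString n, mutProb n (s.1 i) y *
      ∑ j ∈ worstS (fun x y => d x y) κ s.1 y,
        ((worstS (fun x y => d x y) κ s.1 y).card : ℝ≥0∞)⁻¹ * V (nextS s y j) := by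
  have e : ∀ s', trans n μ d (n / 2) κ s s' = ∑ i : Fin μ, (μ : ℝ≥0∞)⁻¹ *
    ∑ y : BitString n, mutProb n (s.1 i) y * innerF s y (cfS d κ s y) s' := fun s' => rfl
  have key : ∀ y, ∑ s', innerF s y (cfS d κ s y) s' * V s' =
      ∑ j ∈ worstS (fun x y => d x y) κ s.1 y,
        ((worstS (fun x y => d x y) κ s.1 y).card : ℝ≥0∞)⁻¹ * V (nextS s y j) := by
    intro y
    have hcf : ∀ a, cfS d κ s y a = if a ∈ clr (fun x y => d x y) κ s.1 y then 0
        else (twoMax (allP s.1 y a) : ℝ) := fun a => rfl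
    have hcf0 : ∀ a, 0 ≤ cfS d κ s y a := by
      intro a; rw [hcf]; split_ifs <;> positivity
    apply innerF_sum
    · ext j
      simp only [worstS, Finset.mem_filter, Finset.mem_univ, true_and]
      constructor
      · intro h
        by_contra hj
        obtain ⟨j0, hj0⟩ := worstS_nonempty (fun x y => d x y) κ hd2 hκ hn hμ s.1 y
        have h1 := h j0
        simp only [worstS, Finset.mem_filter, Finset.mem_univ, true_and] at hj0
        rw [hcf, hcf, if_neg hj, if_pos hj0] at h1
        have : 0 < twoMax (allP s.1 y j.castSucc) := twoMax_pos (by omega) _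
        have : (0 : ℝ) < twoMax (allP s.1 y j.castSucc) := by exact_mod_cast this
        linarith
      · intro h i'
        rw [hcf, if_pos h]
        exact hcf0 _
    · intro j hj
      simp only [worstS, Finset.mem_filter, Finset.mem_univ, true_and] at hj
      rw [hcf j.castSucc, if_pos hj]
      exact hcf0 _
  simp only [e, ← key, Finset.sum_mul, Finset.mul_sum]
  rw [Finset.sum_comm]
  refine Finset.sum_congr rfl fun i _ => ?_
  rw [Finset.sum_comm]
  refine Finset.sum_congr rfl fun y _ => Finset.sum_congr rfl fun s' _ => ?_
  ring

lemma step_le (hd2 : ∀ x y : BitString n, d x y ≤ hammingDist x y) (hκ : 1 ≤ κ) (hn : 33 ≤ n)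
    (hμ : κ * n ^ 2 ≤ 4 * μ) (s : State n μ) (V : State n μ → ℝ≥0∞) (v : State n μ → ℝ)
    (hv : ∀ s, 0 ≤ v s)
    (hV : ∀ y, ∀ j ∈ worstS (fun x y => d x y) κ s.1 y,
      V (nextS s y j) = ENNReal.ofReal (v (nextS s y j)))
    (g : Fin μ → BitString n → ℝ)
    (hg : ∀ i y, (∑ j ∈ worstS (fun x y => d x y) κ s.1 y, v (nextS s y j)) ≤
      (worstS (fun x y => d x y) κ s.1 y).card * g i y) :
    ∑ s', trans n μ d (n / 2) κ s s' * V s' ≤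
      ENNReal.ofReal (∑ i, (μ : ℝ)⁻¹ * ∑ y, mr (s.1 i) y * g i y) := by
  have hμ0 : 0 < μ := by
    rcases Nat.eq_zero_or_pos μ with h | h
    · subst h
      have : 0 < κ * n ^ 2 := Nat.mul_pos hκ (by positivity)
      omega
    · exact h
  have hμ' : (0 : ℝ) < μ := by exact_mod_cast hμ0
  have hg0 : ∀ i y, 0 ≤ g i y := by
    intro i y
    have h1 : 0 ≤ ∑ j ∈ worstS (fun x y => d x y) κ s.1 y, v (nextS s y j) :=
      Finset.sum_nonneg fun _ _ => hv _
    have h2 : (0 : ℝ) < (worstS (fun x y => d x y) κ s.1 y).card := by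
      have := (worstS_nonempty (fun x y => d x y) κ hd2 hκ hn hμ s.1 y).card_pos
      exact_mod_cast this
    have h3 := h1.trans (hg i y)
    exact nonneg_of_mul_nonneg_right h3 h2
  have hm : ∀ i y, 0 ≤ mr (s.1 i) y * g i y := fun i y =>
    mul_nonneg (mr_nonneg (by omega) _ _) (hg0 i y)
  rw [trans_sum d κ hd2 hκ hn hμ]
  rw [ENNReal.ofReal_sum_of_nonneg (fun i _ => by
    have := Finset.sum_nonneg (s := Finset.univ) fun y _ => hm i y
    positivity)]
  refine Finset.sum_le_sum fun i _ => ?_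
  rw [ENNReal.ofReal_mul (by positivity), ENNReal.ofReal_inv_of_pos hμ', ENNReal.ofReal_natCast]
  gcongr
  rw [ENNReal.ofReal_sum_of_nonneg (fun y _ => hm i y)]
  refine Finset.sum_le_sum fun y _ => ?_
  rw [ENNReal.ofReal_mul (mr_nonneg (by omega) _ _), mutProb_eq (by omega)]
  gcongr
  rw [← Finset.mul_sum, Finset.sum_congr rfl (hV y),
    ← ENNReal.ofReal_sum_of_nonneg (fun _ _ => hv _)]
  have h2 := (worstS_nonempty (fun x y => d x y) κ hd2 hκ hn hμ s.1 y).card_pos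
  have h2' : (0 : ℝ) < (worstS (fun x y => d x y) κ s.1 y).card := by exact_mod_cast h2
  rw [← ENNReal.ofReal_natCast, ← ENNReal.ofReal_inv_of_pos h2',
    ← ENNReal.ofReal_mul (by positivity)]
  apply ENNReal.ofReal_le_ofReal
  rw [inv_mul_le_iff₀ h2']
  exact hg i y

end Trans

section Pot
variable {n μ : ℕ}

def flag (s : State n μ) (b : Bool) : Bool := if b then s.2.2 else s.2.1

lemma flag_next (s : State n μ) (y : BitString n) (j : Fin μ) (b : Bool) :
    flag (nextS s y j) b = (flag s b || decide (y = opt n b)) := by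
  cases b <;> rfl

lemma both_iff (s : State n μ) (b : Bool) :
    bothFound s ↔ flag s b = true ∧ flag s (!b) = true := by
  unfold bothFound flag
  cases b <;> simp [and_comm]

def Good (s : State n μ) : Prop :=
  ∀ b, ((∃ i, s.1 i = opt n b) → flag s b = true) ∧
    (flag s b = true → flag s (!b) = false → ∃ i, s.1 i = opt n b)

def RR (n μ k : ℕ) : ℝ := ∑ j ∈ Finset.Ico k n, 12 * (μ : ℝ) * n / (n - j)

def lev1 (P : Fin μ → BitString n) : ℕ := Finset.univ.sup fun i => twoMax (P i)

def lev2 (b : Bool) (P : Fin μ → BitString n) : ℕ :=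
  Finset.univ.sup fun i => if n / 2 ≤ hd b (P i) then twoMax (P i) else 0

def phi (b : Bool) (P : Fin μ → BitString n) : ℝ := ∑ i, (hd b (P i) : ℝ)

def bb (n : ℕ) : ℝ := 2 / n + 4 / ((n : ℝ) ^ 2 - 4)

def DD (b : Bool) (P : Fin μ → BitString n) : ℝ := 1 - bb n * phi b P / μ

def AA (n μ : ℕ) : ℝ := μ * n / 2

def B2 (n μ : ℕ) : ℝ := RR n μ 0 + AA n μ * (4 + 2 * Real.log n)

def v2 (b : Bool) (P : Fin μ → BitString n) : ℝ :=
  if ∃ i, n / 2 ≤ hd b (P i) then RR n μ (lev2 b P)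
  else RR n μ 0 + AA n μ * (4 + 2 * Real.log n + Real.log (DD b P))

def vv (s : State n μ) : ℝ :=
  if bothFound s then 0 else if flag s false then v2 false s.1
  else if flag s true then v2 true s.1 else B2 n μ + RR n μ (lev1 s.1)

lemma RR_term (j : ℕ) (hj : j < n) : 0 ≤ 12 * (μ : ℝ) * n / (n - j) := by
  have : (j : ℝ) < n := by exact_mod_cast hj
  have : 0 < (n : ℝ) - j := by linarith
  positivity

lemma RR_nonneg (k : ℕ) : 0 ≤ RR n μ k :=
  Finset.sum_nonneg fun j hj => RR_term j (Finset.mem_Ico.1 hj).2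

lemma RR_anti {k k' : ℕ} (h : k ≤ k') : RR n μ k' ≤ RR n μ k := by
  apply Finset.sum_le_sum_of_subset_of_nonneg
  · exact Finset.Ico_subset_Ico_left h
  · intro j hj _
    exact RR_term j (Finset.mem_Ico.1 hj).2

lemma RR_step {k k' : ℕ} (h : k < k') (hk : k < n) :
    RR n μ k' ≤ RR n μ k - 12 * (μ : ℝ) * n / (n - k) := by
  have h1 : RR n μ k = 12 * (μ : ℝ) * n / (n - k) + RR n μ (k + 1) := by
    unfold RR
    rw [Finset.sum_eq_sum_Ico_succ_bot hk]
  have := RR_anti (n := n) (μ := μ) (Nat.succ_le_of_lt h)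
  simp only [Nat.succ_eq_add_one] at this
  linarith

lemma RR_zero_le (hn : 1 ≤ n) : RR n μ 0 ≤ 12 * (μ : ℝ) * n * (1 + Real.log n) := by
  have h1 : RR n μ 0 = 12 * (μ : ℝ) * n * (harmonic n : ℝ) := by
    unfold RR harmonic
    push_cast
    rw [Finset.mul_sum, ← Finset.sum_range_reflect, Finset.range_eq_Ico]
    apply Finset.sum_congr rfl
    intro j hj
    have hj' := (Finset.mem_Ico.1 hj).2
    rw [show n - 1 - j = n - (j + 1) by omega, Nat.cast_sub (by omega)]
    push_cast
    rw [div_eq_mul_inv]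
    congr 2
    ring
  rw [h1]
  have := harmonic_le_one_add_log n
  gcongr

lemma bb_facts (hn : 33 ≤ n) : 2 / (n : ℝ) ≤ bb n ∧ 0 < bb n ∧ bb n * n ≤ 3 ∧
    1 / (n : ℝ) ^ 2 ≤ 1 - bb n * ((n - 2) / 2) ∧
    4 / ((n : ℝ) * (n + 2)) = 1 - bb n * ((n - 2) / 2) := by
  have hn' : (33 : ℝ) ≤ n := by exact_mod_cast hn
  have h4 : (0 : ℝ) < (n : ℝ) ^ 2 - 4 := by nlinarith
  have h5 : (0 : ℝ) < n := by linarith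
  have e : 4 / ((n : ℝ) * (n + 2)) = 1 - bb n * ((n - 2) / 2) := by
    unfold bb
    rw [show (n : ℝ) ^ 2 - 4 = (n - 2) * (n + 2) by ring]
    have : (n : ℝ) - 2 ≠ 0 := by linarith
    have : (n : ℝ) + 2 ≠ 0 := by linarith
    field_simp
    ring
  have h2 : 2 / (n : ℝ) ≤ bb n := by
    unfold bb
    have : 0 ≤ 4 / ((n : ℝ) ^ 2 - 4) := by positivity
    linarith
  refine ⟨h2, lt_of_lt_of_le (by positivity) h2, ?_, ?_, e⟩
  · unfold bb
    rw [add_mul, div_mul_cancel₀ _ h5.ne', div_mul_eq_mul_div]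
    have : 4 * (n : ℝ) / ((n : ℝ) ^ 2 - 4) ≤ 1 := by
      rw [div_le_one h4]; nlinarith
    linarith
  · rw [← e, div_le_div_iff₀ (by positivity) (by positivity)]
    nlinarith

lemma phi_nonneg (b : Bool) (P : Fin μ → BitString n) : 0 ≤ phi b P :=
  Finset.sum_nonneg fun _ _ => by positivity

lemma DD_le_one (hn : 33 ≤ n) (b : Bool) (P : Fin μ → BitString n) : DD b P ≤ 1 := by
  have := (bb_facts hn).2.1
  have h2 := phi_nonneg b P
  unfold DD
  have : 0 ≤ bb n * phi b P / μ := by positivity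
  linarith

lemma DD_ge (hn : 33 ≤ n) (hμ : 0 < μ) (b : Bool) (P : Fin μ → BitString n)
    (hP : ∀ i, hd b (P i) < n / 2) : 4 / ((n : ℝ) * (n + 2)) ≤ DD b P := by
  obtain ⟨_, h2, _, _, h5⟩ := bb_facts hn
  rw [h5]
  have hμ' : (0 : ℝ) < μ := by exact_mod_cast hμ
  have h3 : phi b P ≤ μ * ((n - 2) / 2) := by
    unfold phi
    refine (Finset.sum_le_card_nsmul _ _ (((n : ℝ) - 2) / 2) ?_).trans ?_
    · intro i _
      have h1 := hP i
      have h2 : 2 * hd b (P i) + 2 ≤ n := by omega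
      have h3 : (2 : ℝ) * hd b (P i) + 2 ≤ n := by exact_mod_cast h2
      linarith
    · simp
  unfold DD
  have : bb n * phi b P / μ ≤ bb n * ((n - 2) / 2) := by
    rw [div_le_iff₀ hμ']
    nlinarith
  linarith

lemma DD_log (hn : 33 ≤ n) (hμ : 0 < μ) (b : Bool) (P : Fin μ → BitString n)
    (hP : ∀ i, hd b (P i) < n / 2) : 0 < DD b P ∧ 0 ≤ 2 * Real.log n + Real.log (DD b P) ∧
      Real.log (DD b P) ≤ 0 := by
  have h1 := DD_ge hn hμ b P hP
  have hn' : (33 : ℝ) ≤ n := by exact_mod_cast hn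
  obtain ⟨_, h2, _, h4, h5⟩ := bb_facts hn
  have h6 : 1 / (n : ℝ) ^ 2 ≤ DD b P := by rw [← h5] at h4; exact h4.trans h1
  have h7 : (0 : ℝ) < 1 / (n : ℝ) ^ 2 := by positivity
  have h8 : 0 < DD b P := lt_of_lt_of_le h7 h6
  refine ⟨h8, ?_, Real.log_nonpos h8.le (DD_le_one hn b P)⟩
  have := Real.log_le_log h7 h6
  rw [one_div, Real.log_inv, Real.log_pow] at this
  push_cast at this
  linarith

lemma AA_nonneg : 0 ≤ AA n μ := by unfold AA; positivity

lemma v2_bounds (hn : 33 ≤ n) (hμ : 0 < μ) (b : Bool) (P : Fin μ → BitString n) :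
    0 ≤ v2 b P ∧ v2 b P ≤ B2 n μ := by
  have hA := AA_nonneg (n := n) (μ := μ)
  have hl : 0 ≤ Real.log n := Real.log_natCast_nonneg n
  unfold v2 B2
  split_ifs with h
  · refine ⟨RR_nonneg _, ?_⟩
    have := RR_anti (n := n) (μ := μ) (Nat.zero_le (lev2 b P))
    have : 0 ≤ AA n μ * (4 + 2 * Real.log n) := by positivity
    linarith
  · push Not at h
    obtain ⟨h1, h2, h3⟩ := DD_log hn hμ b P h
    have h4 := RR_nonneg (n := n) (μ := μ) 0
    constructor
    · have : 0 ≤ AA n μ * (4 + 2 * Real.log n + Real.log (DD b P)) :=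
        mul_nonneg hA (by linarith)
      linarith
    · have := mul_le_mul_of_nonneg_left
        (show 4 + 2 * Real.log n + Real.log (DD b P) ≤ 4 + 2 * Real.log n by linarith) hA
      linarith

lemma B2_nonneg : 0 ≤ B2 n μ := by
  have hA := AA_nonneg (n := n) (μ := μ)
  have hl : 0 ≤ Real.log n := Real.log_natCast_nonneg n
  have h4 := RR_nonneg (n := n) (μ := μ) 0
  unfold B2
  positivity

lemma vv_bounds (hn : 33 ≤ n) (hμ : 0 < μ) (s : State n μ) :
    0 ≤ vv s ∧ vv s ≤ B2 n μ + RR n μ 0 := by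
  have h1 := B2_nonneg (n := n) (μ := μ)
  have h2 := RR_nonneg (n := n) (μ := μ) 0
  unfold vv
  split_ifs
  · constructor <;> linarith
  · have := v2_bounds hn hμ false s.1
    constructor <;> linarith
  · have := v2_bounds hn hμ true s.1
    constructor <;> linarith
  · have := RR_anti (n := n) (μ := μ) (Nat.zero_le (lev1 s.1))
    have := RR_nonneg (n := n) (μ := μ) (lev1 s.1)
    constructor <;> linarith

lemma vv_side {s : State n μ} {b : Bool} (h1 : flag s b = true) (h2 : flag s (!b) = false) :
    vv s = v2 b s.1 := by
  have h3 : ¬ bothFound s := by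
    rw [both_iff s b]; simp [h2]
  unfold vv
  rw [if_neg h3]
  cases b
  · simp [h1]
  · simp only [Bool.not_true] at h2
    simp [h1, h2]

lemma vv_none {s : State n μ} (h : ∀ b, flag s b = false) :
    vv s = B2 n μ + RR n μ (lev1 s.1) := by
  have h3 : ¬ bothFound s := by
    rw [both_iff s false]; simp [h]
  unfold vv
  rw [if_neg h3]
  simp [h]

lemma vv_some (hn : 33 ≤ n) (hμ : 0 < μ) {s : State n μ} {b : Bool} (h1 : flag s b = true) :
    vv s ≤ B2 n μ := by
  by_cases h : flag s (!b) = true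
  · unfold vv
    rw [if_pos ((both_iff s b).2 ⟨h1, h⟩)]
    exact B2_nonneg
  · rw [vv_side h1 (by simpa using h)]
    exact (v2_bounds hn hμ b s.1).2

lemma vv_both {s : State n μ} (h : bothFound s) : vv s = 0 := by
  unfold vv; rw [if_pos h]

end Pot

section Drift
variable {n μ : ℕ} (d : BitString n → BitString n → ℕ) (κ : ℕ)

lemma allP_forall {p : BitString n → Prop} {P : Fin μ → BitString n} {y : BitString n}
    (h : ∀ i, p (P i)) (hy : p y) : ∀ a, p (allP P y a) := by
  intro a
  induction a using Fin.lastCases with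
  | last => simpa using hy
  | cast i => simpa using h i

lemma good_next (hn : 33 ≤ n) {s : State n μ} (hs : Good s) {y : BitString n} {j : Fin μ}
    (hj : j ∈ worstS d κ s.1 y) : Good (nextS s y j) := by
  intro b
  rw [flag_next, flag_next]
  constructor
  · rintro ⟨i, hi⟩
    change Function.update s.1 j y i = opt n b at hi
    by_cases h : i = j
    · subst h
      simp at hi
      simp [hi]
    · rw [Function.update_of_ne h] at hi
      simp [(hs b).1 ⟨i, hi⟩]
  · intro h1 h2
    change ∃ i, Function.update s.1 j y i = opt n b
    by_cases hy : y = opt n b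
    · exact ⟨j, by simp [hy]⟩
    · simp only [Bool.or_eq_true, decide_eq_true_eq, hy, or_false] at h1
      simp only [Bool.or_eq_false_iff, decide_eq_false_iff_not] at h2
      obtain ⟨i, hi⟩ := (hs b).2 h1 h2.1
      obtain ⟨w, _, _, hw, hw2⟩ := srt_head_opt d κ (by omega) b (P := s.1) (y := y)
        ⟨i.castSucc, by simpa using hi⟩ (allP_forall (p := fun x => x ≠ opt n (!b)) (fun i hi => by
          have := (hs (!b)).1 ⟨i, hi⟩
          simp [h2.1] at this) h2.2)
      rw [← hw2]
      exact contains_of_not_cleared d κ hj hw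

def Drift (s : State n μ) : Prop :=
  ∃ g : Fin μ → BitString n → ℝ,
    (∀ i y, ∑ j ∈ worstS d κ s.1 y, vv (nextS s y j) ≤ (worstS d κ s.1 y).card * g i y) ∧
    ∑ i, (μ : ℝ)⁻¹ * ∑ y, mr (s.1 i) y * g i y ≤ vv s - 1

lemma level_step (hμ0 : 0 < μ) (s : State n μ) (i0 : Fin μ) (b : Bool) (r : ℕ) (δ : ℝ)
    (hδ : 0 ≤ δ)
    (h1 : ∀ y, ∀ j ∈ worstS d κ s.1 y, vv (nextS s y j) ≤ vv s)
    (h2 : ∀ y, hd b y = hd b (s.1 i0) + r → ∀ j ∈ worstS d κ s.1 y,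
      vv (nextS s y j) ≤ vv s - δ) (p : ℝ)
    (hp : p ≤ ∑ y, if hd b y = hd b (s.1 i0) + r then mr (s.1 i0) y else 0)
    (hδp : μ ≤ δ * p) : Drift d κ s := by
  have hμ' : (0 : ℝ) < μ := by exact_mod_cast hμ0
  refine ⟨fun i y => vv s - if i = i0 then (if hd b y = hd b (s.1 i0) + r then δ else 0) else 0,
    ?_, ?_⟩
  · intro i y
    rw [← nsmul_eq_mul]
    apply Finset.sum_le_card_nsmul
    intro j hj
    have h1 := h1 y j hj
    have h2 := fun h => h2 y h j hj
    dsimp only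
    split_ifs with h3 h4
    · exact h2 h4
    · linarith
    · linarith
  · have e : ∀ i, ∑ y, mr (s.1 i) y * (vv s - if i = i0 then
        (if hd b y = hd b (s.1 i0) + r then δ else 0) else 0) =
        vv s - if i = i0 then
          δ * ∑ y, (if hd b y = hd b (s.1 i0) + r then mr (s.1 i0) y else 0) else 0 := by
      intro i
      simp only [mul_sub, Finset.sum_sub_distrib, ← Finset.sum_mul, mr_sum, one_mul]
      congr 1
      split_ifs with h
      · subst h
        rw [Finset.mul_sum]
        apply Finset.sum_congr rfl
        intro y _
        split_ifs <;> ring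
      · simp
    simp only [e]
    rw [← Finset.mul_sum, Finset.sum_sub_distrib]
    simp only [Finset.sum_const, Finset.card_univ, Fintype.card_fin, nsmul_eq_mul,
      Finset.sum_ite_eq', Finset.mem_univ, if_true]
    have h3 : (μ : ℝ) ≤ δ * ∑ y, (if hd b y = hd b (s.1 i0) + r then mr (s.1 i0) y else 0) :=
      hδp.trans (by gcongr)
    rw [mul_sub, inv_mul_cancel_left₀ hμ'.ne']
    have := mul_le_mul_of_nonneg_left h3 (inv_nonneg.2 hμ'.le)
    rw [inv_mul_cancel₀ hμ'.ne'] at this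
    linarith

lemma prob_one (hn : 33 ≤ n) (b : Bool) (x : BitString n) {k : ℕ} (hk : hd b x = k) (hkn : k < n) :
    ((n : ℝ) - k) / (3 * n) ≤ ∑ y, if hd b y = hd b x + 1 then mr x y else 0 := by
  refine le_trans ?_ (mr_flip (by omega) b x 1)
  have h1 := pow_lower (n := n) (by omega) (n - 1) le_rfl
  have hkn' : (k : ℝ) < n := by exact_mod_cast hkn
  have hn' : (33 : ℝ) ≤ n := by exact_mod_cast hn
  rw [hk, Nat.choose_one_right, Nat.cast_sub hkn.le, pow_one]
  have e : ((n : ℝ) - k) / (3 * n) = (n - k) * ((n : ℝ)⁻¹ * (1 / 3)) := by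
    field_simp
  rw [e]
  have : 0 ≤ (n : ℝ) - k := by linarith
  gcongr

lemma delta_one (hn : 33 ≤ n) {k : ℕ} (hkn : k < n) :
    (μ : ℝ) ≤ 12 * (μ : ℝ) * n / (n - k) * (((n : ℝ) - k) / (3 * n)) := by
  have hkn' : (k : ℝ) < n := by exact_mod_cast hkn
  have hn' : (33 : ℝ) ≤ n := by exact_mod_cast hn
  have h : (n : ℝ) - k ≠ 0 := by linarith
  have e : 12 * (μ : ℝ) * n / (n - k) * (((n : ℝ) - k) / (3 * n)) = 4 * μ := by
    field_simp
    ring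
  rw [e]
  have : (0 : ℝ) ≤ μ := by positivity
  linarith

lemma next_pop (s : State n μ) (y : BitString n) (j : Fin μ) :
    (nextS s y j).1 = Function.update s.1 j y := rfl

lemma phase1 (hn : 33 ≤ n) (hμ0 : 0 < μ) {s : State n μ} (hs : Good s)
    (hf : ∀ b, flag s b = false) : Drift d κ s := by
  have : Nonempty (Fin μ) := ⟨⟨0, hμ0⟩⟩
  obtain ⟨i0, -, hi0⟩ := Finset.exists_mem_eq_sup (Finset.univ : Finset (Fin μ))
    Finset.univ_nonempty (fun i => twoMax (s.1 i))
  change lev1 s.1 = _ at hi0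
  have hno : ∀ b i, s.1 i ≠ opt n b := by
    intro b i hi
    have := (hs b).1 ⟨i, hi⟩
    simp [hf] at this
  have hkn : lev1 s.1 < n := by
    rw [hi0]
    refine lt_of_le_of_ne (twoMax_le _) ?_
    intro h
    rcases (twoMax_eq_n (by omega) false).1 h with h | h
    · exact hno _ _ h
    · exact hno _ _ h
  obtain ⟨b, hb⟩ : ∃ b, hd b (s.1 i0) = lev1 s.1 := by
    rw [hi0, twoMax_hd false]
    rcases le_total (hd false (s.1 i0)) (n - hd false (s.1 i0)) with h | h
    · exact ⟨!false, by rw [hd_not]; omega⟩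
    · exact ⟨false, by omega⟩
  have hkn' : (lev1 s.1 : ℝ) < n := by exact_mod_cast hkn
  have hlev : ∀ y, ∀ j ∈ worstS d κ s.1 y,
      lev1 s.1 ≤ lev1 (nextS s y j).1 ∧ twoMax y ≤ lev1 (nextS s y j).1 := by
    intro y j hj
    obtain ⟨w, _, _, hw, hmax⟩ := srt_cons d κ s.1 y
    obtain ⟨i, hi⟩ := contains_of_not_cleared d κ hj hw
    have h1 : twoMax (allP s.1 y w) ≤ lev1 (nextS s y j).1 := by
      rw [next_pop, ← hi]
      exact Finset.le_sup (f := fun i => twoMax (Function.update s.1 j y i)) (Finset.mem_univ i)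
    constructor
    · rw [hi0]
      have := hmax i0.castSucc
      rw [allP_castSucc] at this
      exact this.trans h1
    · have := hmax (Fin.last μ)
      rw [allP_last] at this
      exact this.trans h1
  have hvs := vv_none hf
  have hδ0 : 0 ≤ 12 * (μ : ℝ) * n / (n - lev1 s.1) := RR_term _ hkn
  have hstepn := RR_step (n := n) (μ := μ) hkn hkn
  have hRn := RR_nonneg (n := n) (μ := μ) n
  have hflag : ∀ y j b, flag (nextS s y j) b = true →
      vv (nextS s y j) ≤ vv s - 12 * (μ : ℝ) * n / (n - lev1 s.1) := by
    intro y j b h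
    have := vv_some hn hμ0 h
    linarith
  refine level_step d κ hμ0 s i0 b 1 _ hδ0 ?_ ?_ _ (prob_one hn b _ hb hkn) (delta_one hn hkn)
  · intro y j hj
    by_cases h : ∃ b, flag (nextS s y j) b = true
    · obtain ⟨b, h⟩ := h
      have := hflag y j b h
      linarith
    · push Not at h
      rw [vv_none (by simpa using h), hvs]
      have := RR_anti (n := n) (μ := μ) (hlev y j hj).1
      linarith
  · intro y hy j hj
    by_cases h : ∃ b, flag (nextS s y j) b = true
    · obtain ⟨b, h⟩ := h
      exact hflag y j b h
    · push Not at h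
      rw [vv_none (by simpa using h), hvs]
      have h2 : lev1 s.1 < lev1 (nextS s y j).1 := by
        refine lt_of_lt_of_le ?_ (hlev y j hj).2
        rw [twoMax_hd b]
        omega
      have := RR_step (n := n) (μ := μ) h2 hkn
      linarith

end Drift

section Drift2
variable {n μ : ℕ} (d : BitString n → BitString n → ℕ) (κ : ℕ)

lemma next_side {s : State n μ} {b : Bool} (hb : flag s b = true) (hb' : flag s (!b) = false)
    {y : BitString n} (hy : y ≠ opt n (!b)) (j : Fin μ) :
    vv (nextS s y j) = v2 b (Function.update s.1 j y) := by
  rw [vv_side (b := b)]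
  · rfl
  · rw [flag_next]; simp [hb]
  · rw [flag_next]; simp [hb', hy]

lemma next_done {s : State n μ} {b : Bool} (hb : flag s b = true) (j : Fin μ) :
    vv (nextS s (opt n (!b)) j) = 0 := by
  apply vv_both
  rw [both_iff _ b, flag_next, flag_next]
  simp [hb]

lemma phase2b (hd1 : ∀ x y, pheDist x y ≤ d x y) (hd2 : ∀ x y, d x y ≤ hammingDist x y)
    (hκ : 1 ≤ κ) (hn : 33 ≤ n) (hμ0 : 0 < μ) {s : State n μ} (hs : Good s) {b : Bool}
    (hb : flag s b = true) (hb' : flag s (!b) = false) (hfar : ∃ i, n / 2 ≤ hd b (s.1 i)) :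
    Drift d κ s := by
  have : Nonempty (Fin μ) := ⟨⟨0, hμ0⟩⟩
  obtain ⟨i0, -, hi0⟩ := Finset.exists_mem_eq_sup (Finset.univ : Finset (Fin μ))
    Finset.univ_nonempty (fun i => if n / 2 ≤ hd b (s.1 i) then twoMax (s.1 i) else 0)
  change lev2 b s.1 = _ at hi0
  have hno : ∀ i, s.1 i ≠ opt n (!b) := by
    intro i hi
    have := (hs (!b)).1 ⟨i, hi⟩
    simp [hb'] at this
  have hfar0 : n / 2 ≤ hd b (s.1 i0) := by
    by_contra h
    rw [if_neg h] at hi0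
    obtain ⟨i, hi⟩ := hfar
    have h1 := Finset.le_sup (f := fun i => if n / 2 ≤ hd b (s.1 i) then twoMax (s.1 i) else 0)
      (Finset.mem_univ i)
    simp only [if_pos hi] at h1
    change _ ≤ lev2 b s.1 at h1
    have := twoMax_pos (by omega) (s.1 i)
    omega
  rw [if_pos hfar0] at hi0
  have hvs : vv s = RR n μ (lev2 b s.1) := by
    rw [vv_side hb hb']
    unfold v2
    rw [if_pos hfar]
  have hne : hd b (s.1 i0) ≠ n := fun h => hno i0 (hd_eq_n.1 h)
  have hle := hd_le b (s.1 i0)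
  have hkmax := twoMax_hd b (s.1 i0)
  have hkn : lev2 b s.1 < n := by
    rw [hi0, hkmax]; omega
  have hopt : ∃ i, s.1 i = opt n b := (hs b).2 hb hb'
  have claim : ∀ y, ∀ j ∈ worstS d κ s.1 y, ∀ a, n / 2 ≤ hd b (allP s.1 y a) →
      vv (nextS s y j) ≤ RR n μ (twoMax (allP s.1 y a)) := by
    intro y j hj a ha
    by_cases hy : y = opt n (!b)
    · rw [hy, next_done hb]
      exact RR_nonneg _
    · rw [next_side hb hb' hy]
      obtain ⟨i, hi⟩ := hopt
      obtain ⟨u, hu1, hu2, hu3⟩ := far_kept d κ hd1 hd2 hκ hn b (P := s.1) (y := y)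
        ⟨i.castSucc, by simpa using hi⟩
        (allP_forall (p := fun x => x ≠ opt n (!b)) hno hy) a ha
      obtain ⟨i', hi'⟩ := contains_of_not_cleared d κ hj hu1
      rw [← hi'] at hu2 hu3
      unfold v2
      rw [if_pos ⟨i', hu2⟩]
      apply RR_anti
      have h1 := Finset.le_sup (f := fun i => if n / 2 ≤ hd b (Function.update s.1 j y i)
        then twoMax (Function.update s.1 j y i) else 0) (Finset.mem_univ i')
      simp only [if_pos hu2] at h1
      exact hu3.trans h1
  have hδ0 : 0 ≤ 12 * (μ : ℝ) * n / (n - lev2 b s.1) := RR_term _ hkn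
  have c1 : ∀ y, ∀ j ∈ worstS d κ s.1 y, vv (nextS s y j) ≤ vv s := by
    intro y j hj
    have := claim y j hj i0.castSucc (by simpa using hfar0)
    rw [allP_castSucc, ← hi0] at this
    rw [hvs]; exact this
  have c2 : ∀ r, lev2 b s.1 < hd b (s.1 i0) + r → ∀ y, hd b y = hd b (s.1 i0) + r →
      ∀ j ∈ worstS d κ s.1 y, vv (nextS s y j) ≤ vv s - 12 * (μ : ℝ) * n / (n - lev2 b s.1) := by
    intro r hr y hy j hj
    have h1 := claim y j hj (Fin.last μ) (by rw [allP_last]; omega)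
    rw [allP_last] at h1
    have h2 : lev2 b s.1 < twoMax y := by
      rw [twoMax_hd b]; omega
    have := RR_step (n := n) (μ := μ) h2 hkn
    linarith
  by_cases hk : hd b (s.1 i0) = lev2 b s.1
  · exact level_step d κ hμ0 s i0 b 1 _ hδ0 c1 (c2 1 (by omega)) _
      (prob_one hn b _ hk hkn) (delta_one hn hkn)
  · have hn2 : n = 2 * hd b (s.1 i0) + 1 := by omega
    have hk2 : lev2 b s.1 = hd b (s.1 i0) + 1 := by omega
    refine level_step d κ hμ0 s i0 b 2 _ hδ0 c1 (c2 2 (by omega)) _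
      (mr_flip (by omega) b _ 2) ?_
    generalize hd b (s.1 i0) = h at *
    rw [hk2, show n - h = h + 1 by omega, Nat.cast_choose_two]
    have h1 := pow_lower (n := n) (by omega) (n - 2) (by omega)
    have hn' : (33 : ℝ) ≤ n := by exact_mod_cast hn
    have hnh : (n : ℝ) = 2 * h + 1 := by exact_mod_cast hn2
    have hh : (0 : ℝ) < h := by linarith
    have hμ' : (0 : ℝ) < μ := by exact_mod_cast hμ0
    have e1 : (n : ℝ) - ((h + 1 : ℕ) : ℝ) = h := by push_cast; linarith
    rw [e1]
    push_cast
    have e2 : 12 * (μ : ℝ) * n / h * (((h : ℝ) + 1) * (h + 1 - 1) / 2 * ((n : ℝ)⁻¹ ^ 2 * (1 / 3)))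
        = μ * (2 * (h + 1) / n) := by
      field_simp
      ring
    have h3 : (1 : ℝ) ≤ 2 * (h + 1) / n := by
      rw [le_div_iff₀ (by linarith)]; linarith
    calc (μ : ℝ) ≤ μ * (2 * (h + 1) / n) := le_mul_of_one_le_right hμ'.le h3
      _ = _ := e2.symm
      _ ≤ _ := by
        have : (0 : ℝ) ≤ h + 1 - 1 := by linarith
        gcongr

lemma phi_update (b : Bool) (P : Fin μ → BitString n) (j : Fin μ) (y : BitString n) :
    phi b (Function.update P j y) = phi b P - hd b (P j) + hd b y := by
  unfold phi
  have h1 : ∀ i, (hd b (Function.update P j y i) : ℝ) =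
      Function.update (fun i => (hd b (P i) : ℝ)) j (hd b y) i := by
    intro i
    by_cases h : i = j
    · subst h; simp
    · simp [Function.update_of_ne h]
  simp only [h1]
  rw [Finset.sum_update_of_mem (Finset.mem_univ j), ← Finset.add_sum_erase _ _ (Finset.mem_univ j),
    Finset.sdiff_singleton_eq_erase]
  ring

lemma phase2a (hd1 : ∀ x y, pheDist x y ≤ d x y) (hd2 : ∀ x y, d x y ≤ hammingDist x y)
    (hκ : 1 ≤ κ) (hn : 33 ≤ n) (hμ0 : 0 < μ) (hμ : κ * n ^ 2 ≤ 4 * μ)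
    {s : State n μ} (hs : Good s) {b : Bool}
    (hb : flag s b = true) (hb' : flag s (!b) = false) (hnear : ∀ i, hd b (s.1 i) < n / 2) :
    Drift d κ s := by
  have hn' : (33 : ℝ) ≤ n := by exact_mod_cast hn
  have hμ' : (0 : ℝ) < μ := by exact_mod_cast hμ0
  have hκ' : (1 : ℝ) ≤ κ := by exact_mod_cast hκ
  have hμn : (κ : ℝ) * (n : ℝ) ^ 2 ≤ 4 * μ := by exact_mod_cast hμ
  have hn2 : (33 : ℝ) ^ 2 ≤ (n : ℝ) ^ 2 := by gcongr
  have hn2μ : (n : ℝ) ^ 2 ≤ 4 * μ := by nlinarith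
  have hκμ : (κ : ℝ) < μ := by nlinarith
  obtain ⟨hbb1, hbb0, hbb3, -, -⟩ := bb_facts hn
  have hA := AA_nonneg (n := n) (μ := μ)
  obtain ⟨hD0, hD1, hD2⟩ := DD_log hn hμ0 b s.1 hnear
  have hDge := DD_ge hn hμ0 b s.1 hnear
  have hφ0 := phi_nonneg b s.1
  set D := DD b s.1 with hDdef
  set φ := phi b s.1 with hφ
  have hc0 : 0 ≤ AA n μ * bb n / (μ * D) := by positivity
  set c := AA n μ * bb n / (μ * D) with hc
  set m := φ / (μ - κ) with hm
  have hμκ : (0 : ℝ) < μ - κ := by linarith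
  have hm0 : 0 ≤ m := by positivity
  have hopt : ∃ i, s.1 i = opt n b := (hs b).2 hb hb'
  have hvs : vv s = RR n μ 0 + AA n μ * (4 + 2 * Real.log n + Real.log D) := by
    rw [vv_side hb hb']
    unfold v2
    rw [if_neg (by push Not; exact hnear)]
  have hcD : c * D = n * bb n / 2 := by
    rw [hc]; unfold AA; field_simp
  have hcn : c * n ≤ 4 * AA n μ := by
    have h1 : 3 / 4 ≤ μ * D := by
      calc (3 / 4 : ℝ) ≤ (n : ℝ) ^ 2 / 4 * (4 / (n * (n + 2))) := by
            rw [show (n : ℝ) ^ 2 / 4 * (4 / (n * (n + 2))) = n / (n + 2) by field_simp]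
            rw [div_le_div_iff₀ (by norm_num) (by linarith)]
            linarith
        _ ≤ μ * D := by
            gcongr
            linarith
    have h2 : c * n = AA n μ * (bb n * n) / (μ * D) := by rw [hc]; ring
    rw [h2, div_le_iff₀ (by linarith)]
    have h3 := mul_le_mul_of_nonneg_left hbb3 hA
    have h4 := mul_le_mul_of_nonneg_left h1 hA
    nlinarith
  refine ⟨fun _ y => vv s - c * (hd b y - m), ?_, ?_⟩
  · intro _ y
    dsimp only
    by_cases hy : hd b y < n / 2
    · have hyo : y ≠ opt n (!b) := by
        intro h
        rw [← hd_eq_n] at h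
        omega
      have hW : (μ : ℝ) ≤ (worstS d κ s.1 y).card + κ := by
        obtain ⟨i, hi⟩ := hopt
        exact_mod_cast near_card d κ hd1 hd2 hκ hn b (P := s.1) (y := y)
          ⟨i.castSucc, by simpa using hi⟩
          (allP_forall (p := fun x => hd b x < n / 2) hnear hy)
      have hj : ∀ j ∈ worstS d κ s.1 y,
          vv (nextS s y j) ≤ vv s - c * hd b y + c * hd b (s.1 j) := by
        intro j _
        have hnear' : ∀ i, hd b (Function.update s.1 j y i) < n / 2 := by
          intro i
          by_cases h : i = j
          · subst h; simpa using hy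
          · rw [Function.update_of_ne h]; exact hnear i
        rw [next_side hb hb' hyo, hvs]
        unfold v2
        rw [if_neg (by push Not; exact hnear')]
        obtain ⟨hE0, -, -⟩ := DD_log hn hμ0 b _ hnear'
        have hE : DD b (Function.update s.1 j y) = D - bb n / μ * (hd b y - hd b (s.1 j)) := by
          rw [hDdef]
          unfold DD
          rw [phi_update]
          ring
        have hlog := Real.log_le_sub_one_of_pos (div_pos hE0 hD0)
        rw [Real.log_div hE0.ne' hD0.ne'] at hlog
        have e1 : DD b (Function.update s.1 j y) / D - 1 =
            - (bb n / (μ * D) * (hd b y - hd b (s.1 j))) := by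
          rw [hE]; field_simp; ring
        rw [e1] at hlog
        have h5 := mul_le_mul_of_nonneg_left hlog hA
        have e2 : AA n μ * -(bb n / (μ * D) * (hd b y - hd b (s.1 j))) =
          - c * hd b y + c * hd b (s.1 j) := by rw [hc]; ring
        rw [e2] at h5
        linarith
      refine (Finset.sum_le_sum hj).trans ?_
      rw [Finset.sum_add_distrib, Finset.sum_const, nsmul_eq_mul, ← Finset.mul_sum]
      have h6 : ∑ j ∈ worstS d κ s.1 y, (hd b (s.1 j) : ℝ) ≤ φ :=
        Finset.sum_le_sum_of_subset_of_nonneg (Finset.subset_univ _) (fun _ _ _ => by positivity)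
      have h7 : φ ≤ (worstS d κ s.1 y).card * m := by
        have : φ = (μ - κ) * m := by rw [hm]; field_simp
        rw [this]
        gcongr
        linarith
      have h8 := mul_le_mul_of_nonneg_left (h6.trans h7) hc0
      linarith
    · push Not at hy
      rw [← nsmul_eq_mul]
      apply Finset.sum_le_card_nsmul
      intro j _
      have h1 : vv (nextS s y j) ≤ RR n μ 0 := by
        by_cases hyo : y = opt n (!b)
        · rw [hyo, next_done hb]
          exact RR_nonneg _
        · rw [next_side hb hb' hyo]
          unfold v2
          rw [if_pos ⟨j, by simpa using hy⟩]
          exact RR_anti (Nat.zero_le _)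
      have h2 : (hd b y : ℝ) ≤ n := by exact_mod_cast hd_le b y
      have h3 : c * (hd b y - m) ≤ c * n := by
        gcongr
        linarith
      have h4 := mul_nonneg hA hD1
      rw [hvs]
      linarith
  · have e : ∀ i, ∑ y, mr (s.1 i) y * (vv s - c * (hd b y - m)) =
        vv s + c * m - c * (hd b (s.1 i) * (1 - 2 / n) + 1) := by
      intro i
      rw [← mr_hd (by omega) b (s.1 i), Finset.mul_sum]
      have : vv s + c * m = ∑ y, mr (s.1 i) y * (vv s + c * m) := by
        rw [← Finset.sum_mul, mr_sum, one_mul]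
      rw [this, ← Finset.sum_sub_distrib]
      apply Finset.sum_congr rfl
      intro y _
      ring
    simp only [e]
    have e5 : ∑ i, ((hd b (s.1 i) : ℝ) * (1 - 2 / n) + 1) = φ * (1 - 2 / n) + μ := by
      rw [Finset.sum_add_distrib, ← Finset.sum_mul]
      simp [hφ, phi]
    rw [← Finset.mul_sum, Finset.sum_sub_distrib, ← Finset.mul_sum, e5, Finset.sum_const,
      Finset.card_univ, Fintype.card_fin, nsmul_eq_mul]
    have e3 : (μ : ℝ)⁻¹ * (μ * (vv s + c * m) - c * (φ * (1 - 2 / n) + μ)) =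
        vv s - c * (φ / μ * (1 - 2 / n) + 1 - m) := by
      field_simp
      ring
    rw [e3]
    have hn4 : (0 : ℝ) < (n : ℝ) ^ 2 - 4 := by linarith
    have hm1 : m ≤ φ / μ * (1 + 4 / ((n : ℝ) ^ 2 - 4)) := by
      rw [hm, div_mul_eq_mul_div, div_le_div_iff₀ hμκ hμ', mul_assoc]
      apply mul_le_mul_of_nonneg_left _ hφ0
      rw [show 1 + 4 / ((n : ℝ) ^ 2 - 4) = (n : ℝ) ^ 2 / ((n : ℝ) ^ 2 - 4) by
        field_simp; ring, div_mul_eq_mul_div, le_div_iff₀ hn4]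
      nlinarith
    have hbr : D ≤ φ / μ * (1 - 2 / n) + 1 - m := by
      have : D = 1 - (2 / n + 4 / ((n : ℝ) ^ 2 - 4)) * φ / μ := rfl
      have e4 : (2 / n + 4 / ((n : ℝ) ^ 2 - 4)) * φ / μ =
        φ / μ * (2 / n + 4 / ((n : ℝ) ^ 2 - 4)) := by ring
      rw [this, e4]
      linarith
    have h9 := mul_le_mul_of_nonneg_left hbr hc0
    rw [hcD] at h9
    have h10 : 1 ≤ n * bb n / 2 := by
      rw [div_le_iff₀ (by linarith)] at hbb1
      linarith
    linarith

end Drift2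

section Main

lemma telescope {S : Type*} [Fintype S] (ini : S → ℝ≥0∞) (tr : S → S → ℝ≥0∞) (A : S → Prop)
    (V : S → ℝ≥0∞) (h : ∀ s, ∑ s', tr s s' * V s' + (if A s then 1 else 0) ≤ V s) (N : ℕ) :
    ∑ T ∈ Finset.range N, probOf (evolve ini tr T) A + ∑ s, evolve ini tr N s * V s ≤
      ∑ s, ini s * V s := by
  induction N with
  | zero => simp [evolve]
  | succ N ih =>
    refine le_trans ?_ ih
    rw [Finset.sum_range_succ, add_assoc]
    gcongr
    have e1 : ∑ s, evolve ini tr (N + 1) s * V s =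
        ∑ s, evolve ini tr N s * ∑ s', tr s s' * V s' := by
      simp only [evolve, Finset.sum_mul, Finset.mul_sum]
      rw [Finset.sum_comm]
      simp only [mul_assoc]
    rw [e1]
    unfold probOf
    rw [← Finset.sum_add_distrib]
    apply Finset.sum_le_sum
    intro s _
    refine le_trans (le_of_eq ?_) (mul_le_mul_right (h s) (evolve ini tr N s))
    rw [mul_add, add_comm]
    congr 1
    split_ifs <;> simp

variable {n μ : ℕ} (d : ∀ {n : ℕ}, BitString n → BitString n → ℕ) (κ : ℕ)

def VV (s : State n μ) : ℝ≥0∞ := if Good s then ENNReal.ofReal (vv s) else ⊤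

lemma drift_all (hd1 : ∀ x y : BitString n, pheDist x y ≤ d x y)
    (hd2 : ∀ x y : BitString n, d x y ≤ hammingDist x y)
    (hκ : 1 ≤ κ) (hn : 33 ≤ n) (hμ0 : 0 < μ) (hμ : κ * n ^ 2 ≤ 4 * μ) (s : State n μ) :
    ∑ s', trans n μ d (n / 2) κ s s' * VV s' + (if ¬ bothFound s then 1 else 0) ≤ VV s := by
  by_cases hs : Good s
  swap
  · unfold VV
    rw [if_neg hs]
    exact le_top
  have hvn : ∀ s : State n μ, 0 ≤ vv s := fun s => (vv_bounds hn hμ0 s).1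
  have hV : ∀ y, ∀ j ∈ worstS (fun x y => d x y) κ s.1 y,
      VV (nextS s y j) = ENNReal.ofReal (vv (nextS s y j)) := by
    intro y j hj
    unfold VV
    rw [if_pos (good_next _ κ hn hs hj)]
  have hVs : VV s = ENNReal.ofReal (vv s) := by unfold VV; rw [if_pos hs]
  by_cases hbf : bothFound s
  · rw [if_neg (by simpa using hbf), add_zero]
    have := step_le d κ hd2 hκ hn hμ s VV vv hvn hV (fun _ _ => 0) (by
      intro i y
      rw [mul_zero]
      apply le_of_eq
      apply Finset.sum_eq_zero
      intro j _
      apply vv_both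
      rw [both_iff _ false] at hbf ⊢
      rw [flag_next, flag_next]
      simp only [hbf.1, hbf.2, Bool.true_or, and_self])
    refine this.trans ?_
    simp
  · rw [if_pos hbf]
    have hdr : Drift (fun x y => d x y) κ s := by
      by_cases h : ∀ b, flag s b = false
      · exact phase1 _ κ hn hμ0 hs h
      · push Not at h
        obtain ⟨b, hb⟩ := h
        have hb : flag s b = true := by simpa using hb
        have hb' : flag s (!b) = false := by
          rw [both_iff s b] at hbf
          simpa [hb] using hbf
        by_cases hfar : ∃ i, n / 2 ≤ hd b (s.1 i)
        · exact phase2b _ κ hd1 hd2 hκ hn hμ0 hs hb hb' hfar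
        · push Not at hfar
          exact phase2a _ κ hd1 hd2 hκ hn hμ0 hμ hs hb hb' hfar
    obtain ⟨g, hg1, hg2⟩ := hdr
    have h1 := step_le d κ hd2 hκ hn hμ s VV vv hvn hV g hg1
    have hg0 : ∀ i y, 0 ≤ g i y := by
      intro i y
      have h2 : 0 ≤ ∑ j ∈ worstS (fun x y => d x y) κ s.1 y, vv (nextS s y j) :=
        Finset.sum_nonneg fun _ _ => hvn _
      have h3 := worstS_nonempty (fun x y => d x y) κ hd2 hκ hn hμ s.1 y
      rw [← Finset.card_pos] at h3
      have h4 : (0 : ℝ) < (worstS (fun x y => d x y) κ s.1 y).card := by exact_mod_cast h3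
      exact nonneg_of_mul_nonneg_right (h2.trans (hg1 i y)) h4
    have h5 : 0 ≤ ∑ i, (μ : ℝ)⁻¹ * ∑ y, mr (s.1 i) y * g i y := by
      apply Finset.sum_nonneg
      intro i _
      apply mul_nonneg (by positivity)
      exact Finset.sum_nonneg fun y _ => mul_nonneg (mr_nonneg (by omega) _ _) (hg0 i y)
    rw [hVs]
    calc _ ≤ ENNReal.ofReal (vv s - 1) + ENNReal.ofReal 1 := by
          rw [ENNReal.ofReal_one]
          gcongr
          exact h1.trans (ENNReal.ofReal_le_ofReal hg2)
      _ = ENNReal.ofReal (vv s) := by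
          rw [← ENNReal.ofReal_add (by linarith) (by norm_num)]
          congr 1
          ring

lemma init_sum : ∑ s : State n μ, init n μ s = 1 := by
  unfold init
  rw [← Finset.mul_sum, Fintype.sum_prod_type]
  have h : ∀ P : Fin μ → BitString n, ∑ f : Bool × Bool,
      (if f.1 = decide (∃ i, P i = allZeros n) ∧ f.2 = decide (∃ i, P i = allOnes n)
        then (1 : ℝ≥0∞) else 0) = 1 := by
    intro P
    simp only [← Prod.mk.injEq, Prod.mk.eta]
    rw [Finset.sum_ite_eq']
    simp
  simp only [h]
  simp only [Finset.sum_const, Finset.card_univ, Fintype.card_pi, Fintype.card_bool,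
    Finset.prod_const, Fintype.card_fin, nsmul_eq_mul, mul_one]
  rw [← pow_mul]
  push_cast
  exact ENNReal.inv_mul_cancel (by simp) (by simp)

lemma init_good (s : State n μ) (h : init n μ s ≠ 0) : Good s := by
  unfold init at h
  have h2 : s.2.1 = decide (∃ i, s.1 i = allZeros n) ∧ s.2.2 = decide (∃ i, s.1 i = allOnes n) := by
    by_contra h3
    rw [if_neg h3] at h
    simp at h
  have key : ∀ b, flag s b = true ↔ ∃ i, s.1 i = opt n b := by
    intro b
    cases b
    · change s.2.1 = true ↔ _
      rw [h2.1, decide_eq_true_eq]; rfl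
    · change s.2.2 = true ↔ _
      rw [h2.2, decide_eq_true_eq]; rfl
  intro b
  exact ⟨(key b).2, fun h _ => (key b).1 h⟩

lemma final_bound (hd1 : ∀ x y : BitString n, pheDist x y ≤ d x y)
    (hd2 : ∀ x y : BitString n, d x y ≤ hammingDist x y)
    (hκ : 1 ≤ κ) (hn : 33 ≤ n) (hμ : κ * n ^ 2 ≤ 4 * μ) :
    expFindBoth n μ d (n / 2) κ ≤ ENNReal.ofReal (60 * μ * n * Real.log n) := by
  have hμ0 : 0 < μ := by
    have : 0 < κ * n ^ 2 := by positivity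
    omega
  have h1 : expFindBoth n μ d (n / 2) κ ≤ ∑ s, init n μ s * VV s := by
    unfold expFindBoth
    rw [ENNReal.tsum_eq_iSup_nat]
    apply iSup_le
    intro N
    exact le_trans le_self_add (telescope (init n μ) (trans n μ d (n / 2) κ) (fun s => ¬ bothFound s)
      VV (fun s => by convert drift_all d κ hd1 hd2 hκ hn hμ0 hμ s) N)
  have h2 : ∑ s : State n μ, init n μ s * VV s ≤ ENNReal.ofReal (B2 n μ + RR n μ 0) := by
    calc ∑ s : State n μ, init n μ s * VV s
        ≤ ∑ s : State n μ, init n μ s * ENNReal.ofReal (B2 n μ + RR n μ 0) := by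
          apply Finset.sum_le_sum
          intro s _
          by_cases h : init n μ s = 0
          · simp [h]
          · gcongr
            unfold VV
            rw [if_pos (init_good s h)]
            exact ENNReal.ofReal_le_ofReal (vv_bounds hn hμ0 s).2
      _ = _ := by rw [← Finset.sum_mul, init_sum, one_mul]
  refine (h1.trans h2).trans (ENNReal.ofReal_le_ofReal ?_)
  have hn' : (33 : ℝ) ≤ n := by exact_mod_cast hn
  have hl : 1 ≤ Real.log n := by
    rw [Real.le_log_iff_exp_le (by linarith)]
    have := Real.exp_one_lt_d9
    linarith
  have h3 := RR_zero_le (n := n) (μ := μ) (by omega)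
  have hx : (0 : ℝ) ≤ μ * n := by positivity
  unfold B2 AA
  nlinarith [mul_le_mul_of_nonneg_left hl hx]

end Main

/-- Covantes Osuna–Sudholt: for every niche capacity κ ≥ 1 and
population size μ with κn²/4 ≤ μ ≤ n^{O(1)}, the expected number of generations until
the (μ+1) EA with genotypic clearing (Hamming distance) or phenotypic clearing, with
clearing radius σ = n/2, has found both optima of TwoMax is O(μ n log n). -/
theorem muPlusOneEA_TwoMax_clearing
    (κ μ : ℕ → ℕ) (hκ : ∀ n, 1 ≤ κ n) (hμlo : ∀ n, κ n * n ^ 2 ≤ 4 * μ n)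
    (hμhi : ∃ C : ℕ, ∀ᶠ n : ℕ in atTop, μ n ≤ n ^ C) :
    ∃ C : ℝ, 0 < C ∧ ∀ᶠ n : ℕ in atTop,
      expFindBoth n (μ n) (fun x y => hammingDist x y) (n / 2) (κ n) ≤
          ENNReal.ofReal (C * μ n * n * Real.log n) ∧
      expFindBoth n (μ n) (fun x y => pheDist x y) (n / 2) (κ n) ≤
          ENNReal.ofReal (C * μ n * n * Real.log n) := by
  refine ⟨60, by norm_num, ?_⟩
  filter_upwards [eventually_ge_atTop 33] with n hn
  exact ⟨final_bound (fun x y => hammingDist x y) (κ n) (fun x y => phe_le x y)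
      (fun _ _ => le_rfl) (hκ n) hn (hμlo n),
    final_bound (fun x y => pheDist x y) (κ n) (fun _ _ => le_rfl)
      (fun x y => phe_le x y) (hκ n) hn (hμlo n)⟩

end Stmt9
end
end
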